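/- (Generalised Barthe formula.) Fix m ∈ ℕ, dimensions n, n₁, …, n_m with n_j ≤ n, surjective linear maps L_i : ℝⁿ → ℝ^{n_i}, and exponents p_i ∈ [0,1]. Set K = ∑_{i=1}^m n_i and identify {1, …, K} with the set of pairs (i,j), 1 ≤ i ≤ m, 1 ≤ j ≤ n_i, via k = n₀ + ⋯ + n_{i−1} + j (n₀ = 0); set q_k = p_i for k in the i-th block. Let 𝓘 be the set of n-element subsets of {1, …, K}. For rotations R_i ∈ SO(n_i) and the standard basis vectors e_i^j of ℝ^{n_i}, define v_k = v_i^j = L_i^* R_i^* e_i^j ∈ ℝⁿ (adjoints with respect to the Euclidean inner products), and for I ∈ 𝓘 let d_I(L, R) = det((v_k)_{k∈I})², the square of the determinant of the n × n matrix whose columns are the vectors v_k, k ∈ I. Then BL(L, p)² = sup { (∏_{k=1}^K λ_k^{q_k}) / (∑_{I∈𝓘} λ_I q_I d_I(L, R)) : λ_k ∈ (0,∞), R_i ∈ SO(n_i) }, where λ_I = ∏_{k∈I} λ_k and q_I = ∏_{k∈I} q_k, both sides being elements of [0,∞] (with x/0 = ∞ for x > 0). -/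

import Mathlib

open MeasureTheory ENNReal Matrix

/-- The Brascamp–Lieb constant `BL(L, p)`, with the linear maps `L i : ℝⁿ → ℝ^{n_i}`
given by matrices acting via `mulVec`: the supremum, over measurable
`f i : ℝ^{n_i} → [0,∞]` with positive finite Lebesgue integral, of
`(∫ ∏ (f i ∘ L i)^(p i)) / ∏ (∫ f i)^(p i)`. -/
noncomputable def brascampLieb {m n : ℕ} {ni : Fin m → ℕ}
    (L : ∀ i, Matrix (Fin (ni i)) (Fin n) ℝ) (p : Fin m → ℝ) : ℝ≥0∞ :=
  ⨆ (f : ∀ i, (Fin (ni i) → ℝ) → ℝ≥0∞) (_ : ∀ i, Measurable (f i))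
    (_ : ∀ i, 0 < ∫⁻ y, f i y) (_ : ∀ i, ∫⁻ y, f i y < ⊤),
    (∫⁻ x : Fin n → ℝ, ∏ i, (f i ((L i).mulVec x)) ^ (p i)) /
      ∏ i, (∫⁻ y, f i y) ^ (p i)

/-- The vector `v_k = v_i^j = L_i^* R_i^* e_i^j ∈ ℝⁿ`, where `k = (i, j)` ranges over
the sigma type `Σ i, Fin (n_i)` (identifying `{1, …, K}`, `K = ∑ n_i`, with blocks),
`e_i^j` is the `j`-th standard basis vector of `ℝ^{n_i}`, and the Euclidean adjoints
`L_i^*, R_i^*` are the transposes. -/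
noncomputable def bartheVec {m n : ℕ} {ni : Fin m → ℕ}
    (L : ∀ i, Matrix (Fin (ni i)) (Fin n) ℝ)
    (R : ∀ i, Matrix.specialOrthogonalGroup (Fin (ni i)) ℝ)
    (k : Σ i : Fin m, Fin (ni i)) : Fin n → ℝ :=
  (L k.1)ᵀ.mulVec
    ((R k.1 : Matrix (Fin (ni k.1)) (Fin (ni k.1)) ℝ)ᵀ.mulVec (Pi.single k.2 1))

/-- `d_I(L, R) = det((v_k)_{k∈I})²`, the squared determinant of the `n × n` matrix
whose columns are the vectors `v_k`, `k ∈ I`. -/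
noncomputable def bartheD {m n : ℕ} {ni : Fin m → ℕ}
    (L : ∀ i, Matrix (Fin (ni i)) (Fin n) ℝ)
    (R : ∀ i, Matrix.specialOrthogonalGroup (Fin (ni i)) ℝ)
    (I : {I : Finset (Σ i : Fin m, Fin (ni i)) // I.card = n}) : ℝ :=
  (Matrix.det (Matrix.of fun (a b : Fin n) =>
    bartheVec L R
      (((Fintype.equivFinOfCardEq ((Fintype.card_coe I.1).trans I.2)).symm b :
        {x // x ∈ I.1}) : Σ i : Fin m, Fin (ni i)) a)) ^ 2

lemma BL.log_one_add_le (r : ℝ) (hr : -1 < r) :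
    Real.log (1 + r) ≤ r - r ^ 2 / 2 + 2 * |r| ^ 3 := by
  by_cases h : |r| ≤ 1 / 2
  · have h1 := Real.abs_log_sub_add_sum_range_le (x := -r) (by rw [abs_neg]; linarith) 2
    have h2 : |r| ^ 3 / (1 - |r|) ≤ 2 * |r| ^ 3 := by
      rw [div_le_iff₀ (by linarith)]
      nlinarith [pow_nonneg (abs_nonneg r) 3]
    simp only [Finset.sum_range_succ, Finset.sum_range_zero, abs_neg, sub_neg_eq_add] at h1
    have h3 := (abs_le.1 h1).2
    norm_num at h3
    linarith
  · push Not at h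
    have h1 := Real.log_le_sub_one_of_pos (show 0 < 1 + r by linarith)
    have h2 : r ^ 2 = |r| ^ 2 := (sq_abs r).symm
    rw [h2]
    nlinarith [pow_pos (show 0 < |r| by linarith) 2]

lemma BL.exp_le_taylor (t : ℝ) :
    Real.exp t ≤ 1 + t + t ^ 2 / 2 + |t| ^ 3 * Real.exp |t| := by
  have h := Complex.norm_exp_sub_sum_le_norm_mul_exp (t : ℂ) 3
  have e : Complex.exp (t : ℂ) - ∑ m ∈ Finset.range 3, (t : ℂ) ^ m / (m.factorial : ℂ)
      = ((Real.exp t - (1 + t + t ^ 2 / 2) : ℝ) : ℂ) := by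
    simp [Finset.sum_range_succ, Nat.factorial]
  rw [e, Complex.norm_real, Complex.norm_real, Real.norm_eq_abs, Real.norm_eq_abs] at h
  have := (abs_le.1 h).2
  linarith

lemma BL.prod_rpow_le {ι : Type*} [Fintype ι] (q : ι → ℝ) (hq : ∀ i, 0 ≤ q i) (R : ℝ) (hR : 0 ≤ R) :
    ∃ K : ℝ, 0 ≤ K ∧ ∀ (r : ι → ℝ) (τ : ℝ), 0 ≤ τ → (∀ i, |r i| ≤ τ) → τ ≤ R → (∀ i, -1 < r i) →
      ∏ i, (1 + r i) ^ q i ≤ 1 + ∑ i, q i * r i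
        + ((∑ i, q i * r i) ^ 2 - ∑ i, q i * r i ^ 2) / 2 + K * τ ^ 3 := by
  set Q := ∑ i, q i with hQ
  have hQ0 : 0 ≤ Q := Finset.sum_nonneg fun i _ => hq i
  set b := Q * (1 + 2 * R) with hb
  have hb0 : 0 ≤ b := by positivity
  set kt := Q + b * R with hkt
  have hkt0 : 0 ≤ kt := by positivity
  refine ⟨2 * Q + (2 * Q * b + b ^ 2 * R) / 2 + kt ^ 3 * Real.exp (kt * R), by positivity, ?_⟩
  intro r τ hτ hr hτR hr1
  set s := ∑ i, q i * r i with hs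
  set u := ∑ i, q i * r i ^ 2 with hu
  set w := ∑ i, q i * |r i| ^ 3 with hw
  have hsb : |s| ≤ Q * τ := by
    rw [hs, hQ, Finset.sum_mul]
    refine (Finset.abs_sum_le_sum_abs _ _).trans (Finset.sum_le_sum fun i _ => ?_)
    rw [abs_mul, abs_of_nonneg (hq i)]
    exact mul_le_mul_of_nonneg_left (hr i) (hq i)
  have hub : u ≤ Q * τ ^ 2 := by
    rw [hu, hQ, Finset.sum_mul]
    refine Finset.sum_le_sum fun i _ => mul_le_mul_of_nonneg_left ?_ (hq i)
    rw [← sq_abs]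
    exact pow_le_pow_left₀ (abs_nonneg _) (hr i) 2
  have hwb : w ≤ Q * τ ^ 3 := by
    rw [hw, hQ, Finset.sum_mul]
    refine Finset.sum_le_sum fun i _ => mul_le_mul_of_nonneg_left ?_ (hq i)
    exact pow_le_pow_left₀ (abs_nonneg _) (hr i) 3
  have hu0 : 0 ≤ u := Finset.sum_nonneg fun i _ => mul_nonneg (hq i) (sq_nonneg _)
  have hw0 : 0 ≤ w := Finset.sum_nonneg fun i _ => mul_nonneg (hq i) (by positivity)
  set d := - u / 2 + 2 * w with hd
  have hτ3 : τ ^ 3 ≤ R * τ ^ 2 := by nlinarith [sq_nonneg τ]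
  have hdb : |d| ≤ b * τ ^ 2 := by
    have : 2 * w ≤ 2 * (Q * (R * τ ^ 2)) := by
      have := mul_le_mul_of_nonneg_left hτ3 hQ0
      linarith
    rw [abs_le]
    constructor
    · have : 0 ≤ Q * R * τ ^ 2 := by positivity
      have : 0 ≤ Q * τ ^ 2 := by positivity
      rw [hb, hd]; nlinarith
    · have : 0 ≤ Q * τ ^ 2 := by positivity
      rw [hb, hd]; nlinarith
  have hP : ∏ i, (1 + r i) ^ q i ≤ Real.exp (s + d) := by
    have : ∏ i, (1 + r i) ^ q i = Real.exp (∑ i, q i * Real.log (1 + r i)) := by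
      rw [Real.exp_sum]
      refine Finset.prod_congr rfl fun i _ => ?_
      rw [Real.rpow_def_of_pos (by linarith [hr1 i]), mul_comm]
    rw [this, Real.exp_le_exp]
    have : s + d = ∑ i, q i * (r i - r i ^ 2 / 2 + 2 * |r i| ^ 3) := by
      rw [hd, hs, hu, hw, neg_div, Finset.sum_div, Finset.mul_sum, ← Finset.sum_neg_distrib,
        ← Finset.sum_add_distrib, ← Finset.sum_add_distrib]
      exact Finset.sum_congr rfl fun i _ => by ring
    rw [this]
    exact Finset.sum_le_sum fun i _ =>
      mul_le_mul_of_nonneg_left (BL.log_one_add_le _ (hr1 i)) (hq i)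
  have hsd : |s + d| ≤ kt * τ := by
    calc |s + d| ≤ |s| + |d| := abs_add_le _ _
      _ ≤ Q * τ + b * τ ^ 2 := add_le_add hsb hdb
      _ ≤ kt * τ := by
        have : b * τ ^ 2 ≤ b * (R * τ) := mul_le_mul_of_nonneg_left (by nlinarith) hb0
        rw [hkt]; linarith
  have h3 : |s + d| ^ 3 * Real.exp |s + d| ≤ kt ^ 3 * Real.exp (kt * R) * τ ^ 3 := by
    have h31 : |s + d| ^ 3 ≤ (kt * τ) ^ 3 := pow_le_pow_left₀ (abs_nonneg _) hsd 3
    have h32 : Real.exp |s + d| ≤ Real.exp (kt * R) := Real.exp_le_exp.2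
      (hsd.trans (mul_le_mul_of_nonneg_left hτR hkt0))
    calc _ ≤ (kt * τ) ^ 3 * Real.exp (kt * R) :=
          mul_le_mul h31 h32 (Real.exp_pos _).le (by positivity)
      _ = _ := by ring
  have h4 : (s + d) ^ 2 ≤ s ^ 2 + (2 * Q * b + b ^ 2 * R) * τ ^ 3 := by
    have h41 : s * d ≤ (Q * τ) * (b * τ ^ 2) := by
      calc s * d ≤ |s * d| := le_abs_self _
        _ = |s| * |d| := abs_mul _ _
        _ ≤ _ := mul_le_mul hsb hdb (abs_nonneg _) (by positivity)
    have h42 : d ^ 2 ≤ (b * τ ^ 2) ^ 2 := by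
      rw [← sq_abs]; exact pow_le_pow_left₀ (abs_nonneg _) hdb 2
    have h43 : (b * τ ^ 2) ^ 2 ≤ b ^ 2 * R * τ ^ 3 := by
      have : τ ^ 4 ≤ R * τ ^ 3 := by nlinarith [pow_nonneg hτ 3]
      calc (b * τ ^ 2) ^ 2 = b ^ 2 * τ ^ 4 := by ring
        _ ≤ b ^ 2 * (R * τ ^ 3) := mul_le_mul_of_nonneg_left this (sq_nonneg _)
        _ = _ := by ring
    nlinarith
  have h5 := BL.exp_le_taylor (s + d)
  have h6 : 2 * w ≤ 2 * Q * τ ^ 3 := by linarith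
  have : s + d = s - u / 2 + 2 * w := by rw [hd]; ring
  nlinarith

section step
open ProbabilityTheory
variable {E : Type*} [NormedAddCommGroup E] [InnerProductSpace ℝ E] [FiniteDimensional ℝ E]
  [MeasurableSpace E] [BorelSpace E]

/-- A class of `C^{1,1}` functions bounded above and below, with gradients in `V`. -/
def BL.Cls (V : Submodule ℝ E) (c C K : ℝ) (G : E → ℝ) : Prop :=
  Measurable G ∧ (∀ x, c ≤ G x ∧ G x ≤ C) ∧
    ∃ w : E → E, Measurable w ∧ (∀ x, w x ∈ V) ∧ (∀ x, ‖w x‖ ≤ K) ∧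
      ∀ x z, |G (x + z) - G x - inner ℝ (w x) z| ≤ K * ‖z‖ ^ 2

lemma BL.integrable_norm_pow (k : ℕ) : Integrable (fun z : E => ‖z‖ ^ k) (stdGaussian E) := by
  by_cases hk : k = 0
  · subst hk; simp
  have := (IsGaussian.memLp_id (stdGaussian E) k (by simp)).integrable_norm_pow hk
  simpa using this

lemma BL.integrable_N_pow (k : ℕ) : Integrable (fun z : E => (1 + ‖z‖ ^ 2) ^ k) (stdGaussian E) := by
  have : (fun z : E => (1 + ‖z‖ ^ 2) ^ k) =
      fun z => ∑ m ∈ Finset.range (k + 1), (‖z‖ ^ (2 * (k - m))) * (k.choose m : ℝ) := by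
    ext z; rw [add_pow]; simp [pow_mul]
  rw [this]
  exact integrable_finsetSum _ fun i _ => (BL.integrable_norm_pow _).mul_const _

lemma BL.integral_inner (u : E) : ∫ z, inner ℝ u z ∂(stdGaussian E) = 0 := by
  have := integral_strongDual_stdGaussian (innerSL ℝ u : StrongDual ℝ E)
  simpa using this

lemma BL.integrable_inner (u : E) : Integrable (fun z => inner ℝ u z) (stdGaussian E) := by
  refine ((BL.integrable_norm_pow (E := E) 1).const_mul ‖u‖).mono' (by fun_prop) ?_
  filter_upwards with z
  simpa using norm_inner_le_norm (𝕜 := ℝ) u z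

lemma BL.integrable_inner_sq (u : E) : Integrable (fun z => (inner ℝ u z) ^ 2) (stdGaussian E) := by
  refine ((BL.integrable_norm_pow (E := E) 2).const_mul (‖u‖ ^ 2)).mono' (by fun_prop) ?_
  filter_upwards with z
  rw [Real.norm_eq_abs, abs_pow, ← mul_pow]
  exact pow_le_pow_left₀ (abs_nonneg _) (by simpa using norm_inner_le_norm (𝕜 := ℝ) u z) 2

lemma BL.integral_inner_sq (u : E) : ∫ z, (inner ℝ u z) ^ 2 ∂(stdGaussian E) = ‖u‖ ^ 2 := by
  have h := variance_dual_stdGaussian (innerSL ℝ u : StrongDual ℝ E)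
  rw [variance_of_integral_eq_zero (by fun_prop) (integral_strongDual_stdGaussian _)] at h
  simpa using h

set_option maxHeartbeats 2000000 in
lemma BL.one_step {ι : Type*} [Fintype ι] (q : ι → ℝ) (hq : ∀ i, 0 ≤ q i)
    (V : ι → Submodule ℝ E)
    (hV : ∀ w : ι → E, (∀ i, w i ∈ V i) → ‖∑ i, q i • w i‖ ^ 2 ≤ ∑ i, q i * ‖w i‖ ^ 2)
    (c C K : ℝ) (hc : 0 < c) (hcC : c ≤ C) (hK : 0 ≤ K) :
    ∃ K' : ℝ, 0 ≤ K' ∧ ∀ η : ℝ, 0 < η → η ≤ 1 → ∀ G : ι → E → ℝ, (∀ i, BL.Cls (V i) c C K (G i)) →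
      ∀ x, ∫ z, ∏ i, G i (x + η • z) ^ q i ∂(stdGaussian E) ≤
        (1 + K' * η ^ 3) * ∏ i, (∫ z, G i (x + η • z) ∂(stdGaussian E)) ^ q i := by
  set μ := stdGaussian E with hμ
  have hC : 0 < C := hc.trans_le hcC
  have hCc : 0 ≤ C / c := by positivity
  obtain ⟨K3, hK30, hK3⟩ := BL.prod_rpow_le q hq (C / c + 1) (by positivity)
  set m2 := ∫ z, ‖z‖ ^ 2 ∂μ with hm2
  have hm20 : 0 ≤ m2 := integral_nonneg fun z => by positivity
  set Q := ∑ i, q i with hQ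
  have hQ0 : 0 ≤ Q := Finset.sum_nonneg fun i _ => hq i
  set K2 := K / c * (1 + m2) with hK2
  have hK20 : 0 ≤ K2 := by positivity
  set K4 := 3 * Q ^ 2 * K2 ^ 2 + 2 * Q * K2 ^ 2 with hK4
  set N2 := ∫ z, (1 + ‖z‖ ^ 2) ^ 2 ∂μ with hN2
  set N3 := ∫ z, (1 + ‖z‖ ^ 2) ^ 3 ∂μ with hN3
  have hN20 : 0 ≤ N2 := integral_nonneg fun z => by positivity
  have hN30 : 0 ≤ N3 := integral_nonneg fun z => by positivity
  refine ⟨K4 / 2 * N2 + K3 * (8 * K2 ^ 3) * N3, by positivity, ?_⟩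
  intro η hη hη1 G hG x
  choose hGm hGb w hwm hwV hwK hwT using hG
  have hGi : ∀ i, Integrable (fun z => G i (x + η • z)) μ := fun i =>
    Integrable.of_bound (C := C) ((hGm i).comp (by fun_prop)).aestronglyMeasurable
      (Filter.Eventually.of_forall fun z => by
        rw [Real.norm_eq_abs, abs_of_pos (hc.trans_le (hGb i _).1)]; exact (hGb i _).2)
  set ρ := fun i => ∫ z, G i (x + η • z) ∂μ with hρ
  have hρc : ∀ i, c ≤ ρ i := fun i => by
    have := integral_mono (μ := μ) (integrable_const c) (hGi i) (fun z => (hGb i _).1)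
    simpa using this
  have hρ0 : ∀ i, 0 < ρ i := fun i => hc.trans_le (hρc i)
  set r := fun i z => G i (x + η • z) / ρ i - 1 with hr
  set u := fun i => (η / ρ i) • w i x with hu
  set a := fun i z => inner ℝ (u i) z with ha
  have hGρ : ∀ i, |G i x - ρ i| ≤ K * η ^ 2 * m2 := by
    intro i
    have h1 : G i x - ρ i = ∫ z, -(G i (x + η • z) - G i x - inner ℝ (w i x) (η • z)) ∂μ := by
      have hin : Integrable (fun z => inner ℝ (w i x) (η • z)) μ := by
        simp_rw [real_inner_smul_right]
        exact (BL.integrable_inner _).const_mul _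
      have hin2 : Integrable (fun z => G i (x + η • z) - G i x) μ := (hGi i).sub (integrable_const _)
      rw [integral_neg, integral_sub hin2 hin, integral_sub (hGi i) (integrable_const _)]
      simp_rw [real_inner_smul_right]
      rw [integral_const_mul, BL.integral_inner]
      simp [hρ]
    rw [h1]
    refine (abs_integral_le_integral_abs).trans ?_
    have h2 : K * η ^ 2 * m2 = ∫ z, K * η ^ 2 * ‖z‖ ^ 2 ∂μ := by
      rw [integral_const_mul]
    rw [h2]
    refine integral_mono_of_nonneg (Filter.Eventually.of_forall fun z => abs_nonneg _)
      ((BL.integrable_norm_pow 2).const_mul _) (Filter.Eventually.of_forall fun z => ?_)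
    simp only [abs_neg]
    refine (hwT i x (η • z)).trans (le_of_eq ?_)
    rw [norm_smul, Real.norm_eq_abs, abs_of_pos hη]; ring
  have hab : ∀ i z, |a i z| ≤ K2 * η * (1 + ‖z‖ ^ 2) := by
    intro i z
    have h1 : |a i z| ≤ ‖u i‖ * ‖z‖ := by simpa using norm_inner_le_norm (𝕜 := ℝ) (u i) z
    have h2 : ‖u i‖ ≤ K / c * η := by
      rw [hu, norm_smul, Real.norm_eq_abs, abs_of_pos (div_pos hη (hρ0 i))]
      calc η / ρ i * ‖w i x‖ ≤ η / c * K := by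
            gcongr
            · exact hρc i
            · exact hwK i x
        _ = _ := by ring
    have h3 : ‖z‖ ≤ 1 + ‖z‖ ^ 2 := by nlinarith [sq_nonneg (‖z‖ - 1), norm_nonneg z]
    calc |a i z| ≤ (K / c * η) * (1 + ‖z‖ ^ 2) := h1.trans (by gcongr)
      _ ≤ _ := by
        have : K / c ≤ K2 := by rw [hK2]; nlinarith [show 0 ≤ K / c by positivity]
        gcongr
  have heb : ∀ i z, |r i z - a i z| ≤ K2 * η ^ 2 * (1 + ‖z‖ ^ 2) := by
    intro i z
    have h1 : r i z - a i z = ((G i (x + η • z) - G i x - inner ℝ (w i x) (η • z))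
        + (G i x - ρ i)) / ρ i := by
      simp only [hr, ha, hu, real_inner_smul_left, real_inner_smul_right]
      have := (hρ0 i).ne'
      field_simp
      ring
    rw [h1, abs_div, abs_of_pos (hρ0 i), div_le_iff₀ (hρ0 i)]
    have h2 := hwT i x (η • z)
    rw [norm_smul, Real.norm_eq_abs, abs_of_pos hη] at h2
    have h3 : K2 * η ^ 2 * (1 + ‖z‖ ^ 2) * c ≤ K2 * η ^ 2 * (1 + ‖z‖ ^ 2) * ρ i := by
      gcongr; exact hρc i
    have h4 : K2 * c = K * (1 + m2) := by rw [hK2]; field_simp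
    have h5 : K2 * η ^ 2 * (1 + ‖z‖ ^ 2) * c = K * (1 + m2) * η ^ 2 * (1 + ‖z‖ ^ 2) := by
      rw [← h4]; ring
    have h6 : 0 ≤ K * η ^ 2 * (1 + m2 * ‖z‖ ^ 2) := by positivity
    refine (abs_add_le _ _).trans ?_
    have := hGρ i
    nlinarith
  have hrb : ∀ i z, |r i z| ≤ 2 * K2 * η * (1 + ‖z‖ ^ 2) := by
    intro i z
    have h1 : |r i z| ≤ |a i z| + |r i z - a i z| := by
      have := abs_add_le (a i z) (r i z - a i z); simpa using this
    have h2 : K2 * η ^ 2 * (1 + ‖z‖ ^ 2) ≤ K2 * η * (1 + ‖z‖ ^ 2) := by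
      gcongr; nlinarith
    linarith [hab i z, heb i z]
  have hr1 : ∀ i z, -1 < r i z := by
    intro i z
    have : 0 < G i (x + η • z) / ρ i := div_pos (hc.trans_le (hGb i _).1) (hρ0 i)
    simp only [hr]; linarith
  have hrR : ∀ i z, |r i z| ≤ C / c + 1 := by
    intro i z
    have : G i (x + η • z) / ρ i ≤ C / c := by
      have h1 := (hGb i (x + η • z)).2
      have h2 := hρc i
      have : 0 ≤ C := by linarith
      gcongr
    have h2 := hr1 i z
    rw [abs_le]; simp only [hr] at h2 ⊢
    constructor <;> linarith
  -- the pointwise bound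
  have hpt : ∀ z, ∏ i, (1 + r i z) ^ q i ≤ (1 + ∑ i, q i * r i z) +
      (((∑ i, q i * a i z) ^ 2 - ∑ i, q i * a i z ^ 2) / 2 +
      (K4 / 2 * η ^ 3 * (1 + ‖z‖ ^ 2) ^ 2 + K3 * (8 * K2 ^ 3) * η ^ 3 * (1 + ‖z‖ ^ 2) ^ 3)) := by
    intro z
    set N := 1 + ‖z‖ ^ 2 with hN
    have hN0 : 0 ≤ N := by positivity
    have h1 := hK3 (fun i => r i z) (min (2 * K2 * η * N) (C / c + 1)) (by positivity)
      (fun i => le_min (hrb i z) (hrR i z)) (min_le_right _ _) (fun i => hr1 i z)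
    have h2 : K3 * (min (2 * K2 * η * N) (C / c + 1)) ^ 3 ≤ K3 * (8 * K2 ^ 3) * η ^ 3 * N ^ 3 := by
      calc _ ≤ K3 * (2 * K2 * η * N) ^ 3 := by
            refine mul_le_mul_of_nonneg_left (pow_le_pow_left₀ ?_ (min_le_left _ _) 3) hK30
            positivity
        _ = _ := by ring
    have h3 : (∑ i, q i * r i z) ^ 2 ≤ (∑ i, q i * a i z) ^ 2 + 3 * Q ^ 2 * K2 ^ 2 * η ^ 3 * N ^ 2 := by
      have e1 : ∑ i, q i * r i z = ∑ i, q i * a i z + ∑ i, q i * (r i z - a i z) := by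
        rw [← Finset.sum_add_distrib]; exact Finset.sum_congr rfl fun i _ => by ring
      have b1 : |∑ i, q i * a i z| ≤ Q * (K2 * η * N) := by
        rw [hQ, Finset.sum_mul]
        refine (Finset.abs_sum_le_sum_abs _ _).trans (Finset.sum_le_sum fun i _ => ?_)
        rw [abs_mul, abs_of_nonneg (hq i)]
        exact mul_le_mul_of_nonneg_left (hab i z) (hq i)
      have b2 : |∑ i, q i * (r i z - a i z)| ≤ Q * (K2 * η ^ 2 * N) := by
        rw [hQ, Finset.sum_mul]
        refine (Finset.abs_sum_le_sum_abs _ _).trans (Finset.sum_le_sum fun i _ => ?_)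
        rw [abs_mul, abs_of_nonneg (hq i)]
        exact mul_le_mul_of_nonneg_left (heb i z) (hq i)
      rw [e1]
      set Sa := ∑ i, q i * a i z
      set Se := ∑ i, q i * (r i z - a i z)
      have b3 : Sa * Se ≤ Q * (K2 * η * N) * (Q * (K2 * η ^ 2 * N)) := by
        calc Sa * Se ≤ |Sa * Se| := le_abs_self _
          _ = |Sa| * |Se| := abs_mul _ _
          _ ≤ _ := mul_le_mul b1 b2 (abs_nonneg _) (by positivity)
      have b4 : Se ^ 2 ≤ (Q * (K2 * η ^ 2 * N)) ^ 2 := by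
        rw [← sq_abs]; exact pow_le_pow_left₀ (abs_nonneg _) b2 2
      have b5 : (Q * (K2 * η ^ 2 * N)) ^ 2 ≤ Q ^ 2 * K2 ^ 2 * η ^ 3 * N ^ 2 := by
        have : η ^ 4 ≤ η ^ 3 := pow_le_pow_of_le_one hη.le hη1 (by norm_num)
        calc _ = (Q ^ 2 * K2 ^ 2 * N ^ 2) * η ^ 4 := by ring
          _ ≤ (Q ^ 2 * K2 ^ 2 * N ^ 2) * η ^ 3 := by gcongr
          _ = _ := by ring
      have e2 : (Sa + Se) ^ 2 = Sa ^ 2 + 2 * (Sa * Se) + Se ^ 2 := by ring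
      have e3 : Q * (K2 * η * N) * (Q * (K2 * η ^ 2 * N)) = Q ^ 2 * K2 ^ 2 * η ^ 3 * N ^ 2 := by ring
      linarith
    have h4 : ∑ i, q i * a i z ^ 2 - 2 * Q * K2 ^ 2 * η ^ 3 * N ^ 2 ≤ ∑ i, q i * r i z ^ 2 := by
      have e1 : 2 * Q * K2 ^ 2 * η ^ 3 * N ^ 2 = ∑ i, q i * (2 * K2 ^ 2 * η ^ 3 * N ^ 2) := by
        rw [← Finset.sum_mul]; ring
      rw [e1, ← Finset.sum_sub_distrib]
      refine Finset.sum_le_sum fun i _ => ?_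
      rw [← mul_sub]
      refine mul_le_mul_of_nonneg_left ?_ (hq i)
      have b3 : -(a i z * (r i z - a i z)) ≤ (K2 * η * N) * (K2 * η ^ 2 * N) := by
        calc _ ≤ |a i z * (r i z - a i z)| := neg_le_abs _
          _ = |a i z| * |r i z - a i z| := abs_mul _ _
          _ ≤ _ := mul_le_mul (hab i z) (heb i z) (abs_nonneg _) (by positivity)
      have e2 : r i z ^ 2 = a i z ^ 2 + 2 * (a i z * (r i z - a i z)) + (r i z - a i z) ^ 2 := by
        ring
      have e3 : (K2 * η * N) * (K2 * η ^ 2 * N) = K2 ^ 2 * η ^ 3 * N ^ 2 := by ring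
      have := sq_nonneg (r i z - a i z)
      linarith
    have h5 : K4 / 2 * η ^ 3 * N ^ 2 = (3 * Q ^ 2 * K2 ^ 2 * η ^ 3 * N ^ 2
        + 2 * Q * K2 ^ 2 * η ^ 3 * N ^ 2) / 2 := by rw [hK4]; ring
    linarith
  have hri : ∀ i, Integrable (r i) μ := fun i => ((hGi i).div_const _).sub (integrable_const _)
  have hr0 : ∀ i, ∫ z, r i z ∂μ = 0 := by
    intro i
    simp only [hr]
    rw [integral_sub ((hGi i).div_const _) (integrable_const _), integral_div]
    have : (∫ z, G i (x + η • z) ∂μ) / ρ i = 1 := div_self (hρ0 i).ne'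
    rw [this]; simp
  have hI1 : Integrable (fun z => 1 + ∑ i, q i * r i z) μ :=
    (integrable_const _).add (integrable_finsetSum _ fun i _ => (hri i).const_mul _)
  have hsa : ∀ z, ∑ i, q i * a i z = inner ℝ (∑ i, q i • u i) z := by
    intro z; rw [sum_inner]; simp [ha, real_inner_smul_left]
  have hI2a : Integrable (fun z => (∑ i, q i * a i z) ^ 2) μ := by
    simp_rw [hsa]; exact BL.integrable_inner_sq _
  have hI2b : Integrable (fun z => ∑ i, q i * a i z ^ 2) μ :=
    integrable_finsetSum _ fun i _ => (BL.integrable_inner_sq _).const_mul _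
  have hI2 : Integrable (fun z => ((∑ i, q i * a i z) ^ 2 - ∑ i, q i * a i z ^ 2) / 2) μ :=
    (hI2a.sub hI2b).div_const _
  have hI3a : Integrable (fun z : E => K4 / 2 * η ^ 3 * (1 + ‖z‖ ^ 2) ^ 2) μ :=
    (BL.integrable_N_pow 2).const_mul _
  have hI3b : Integrable (fun z : E => K3 * (8 * K2 ^ 3) * η ^ 3 * (1 + ‖z‖ ^ 2) ^ 3) μ :=
    (BL.integrable_N_pow 3).const_mul _
  have hintEq : ∫ z, ∏ i, (1 + r i z) ^ q i ∂μ ≤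
      1 + (K4 / 2 * N2 + K3 * (8 * K2 ^ 3) * N3) * η ^ 3 := by
    have h1 := integral_mono_of_nonneg (μ := μ) (Filter.Eventually.of_forall fun z =>
        Finset.prod_nonneg fun i _ => Real.rpow_nonneg (by linarith [hr1 i z]) _)
      (hI1.add (hI2.add (hI3a.add hI3b))) (Filter.Eventually.of_forall hpt)
    refine h1.trans ?_
    rw [integral_add' hI1 (hI2.add (hI3a.add hI3b)), integral_add' hI2 (hI3a.add hI3b),
      integral_add' hI3a hI3b, integral_const_mul, integral_const_mul]
    have e1 : ∫ z, (1 + ∑ i, q i * r i z) ∂μ = 1 := by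
      rw [integral_add (integrable_const _) (integrable_finsetSum _ fun i _ => (hri i).const_mul _),
        integral_finsetSum _ fun i _ => (hri i).const_mul _]
      simp [integral_const_mul, hr0]
    have e2 : ∫ z, ((∑ i, q i * a i z) ^ 2 - ∑ i, q i * a i z ^ 2) / 2 ∂μ ≤ 0 := by
      have hh : ∀ i, Integrable (fun z => q i * a i z ^ 2) μ :=
        fun i => (BL.integrable_inner_sq _).const_mul _
      rw [integral_div, integral_sub hI2a hI2b, integral_finsetSum _ fun i _ => hh i]
      have e3 : ∀ i, ∫ z, a i z ^ 2 ∂μ = ‖u i‖ ^ 2 := fun i => BL.integral_inner_sq (u i)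
      have e4 : ∫ z, (∑ i, q i * a i z) ^ 2 ∂μ = ‖∑ i, q i • u i‖ ^ 2 := by
        simp_rw [hsa]; exact BL.integral_inner_sq _
      simp_rw [integral_const_mul, e3, e4]
      have := hV u (fun i => Submodule.smul_mem _ _ (hwV i x))
      linarith
    rw [e1]
    linarith
  have hfac : ∀ z, ∏ i, G i (x + η • z) ^ q i = (∏ i, ρ i ^ q i) * ∏ i, (1 + r i z) ^ q i := by
    intro z
    rw [← Finset.prod_mul_distrib]
    refine Finset.prod_congr rfl fun i _ => ?_
    rw [← Real.mul_rpow (hρ0 i).le (by linarith [hr1 i z])]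
    congr 1
    simp only [hr]
    have := (hρ0 i).ne'
    field_simp
    ring
  simp_rw [hfac]
  rw [integral_const_mul, mul_comm]
  exact mul_le_mul_of_nonneg_right hintEq (Finset.prod_nonneg fun i _ => Real.rpow_nonneg (hρ0 i).le _)

end step

section iter
open ProbabilityTheory
variable {E : Type*} [NormedAddCommGroup E] [InnerProductSpace ℝ E] [FiniteDimensional ℝ E]
  [MeasurableSpace E] [BorelSpace E]

lemma BL.integrable_of_bdd {X F : Type*} [MeasurableSpace X] [NormedAddCommGroup F]
    (μ : Measure X) [IsFiniteMeasure μ]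
    (G : X → F) (hG : AEStronglyMeasurable G μ) (C : ℝ) (hC : ∀ x, ‖G x‖ ≤ C) : Integrable G μ :=
  (integrable_const C).mono' hG (Filter.Eventually.of_forall hC)

lemma BL.conv_gauss (η θ ρ : ℝ) (h : η ^ 2 + θ ^ 2 = ρ ^ 2) :
    ((stdGaussian E).map (fun z => η • z)) ∗ ((stdGaussian E).map (fun z => θ • z)) =
      (stdGaussian E).map (fun z => ρ • z) := by
  have hpr : ∀ r : ℝ, IsProbabilityMeasure ((stdGaussian E).map (fun z => r • z)) := fun r =>
    Measure.isProbabilityMeasure_map (by fun_prop)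
  have := hpr η
  have := hpr θ
  have := hpr ρ
  refine Measure.ext_of_charFun ?_
  ext t
  rw [charFun_conv, charFun_map_smul, charFun_map_smul, charFun_map_smul, charFun_stdGaussian,
    charFun_stdGaussian, charFun_stdGaussian, ← Complex.exp_add]
  congr 1
  simp only [norm_smul, Real.norm_eq_abs]
  norm_cast
  simp only [mul_pow, sq_abs]
  rw [← h]; ring

lemma BL.semigroup (η θ ρ : ℝ) (h : η ^ 2 + θ ^ 2 = ρ ^ 2) (G : E → ℝ) (hG : Measurable G)
    (C : ℝ) (hC : ∀ x, ‖G x‖ ≤ C) (x : E) :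
    ∫ z, (∫ z', G (x + η • z + θ • z') ∂(stdGaussian E)) ∂(stdGaussian E) =
      ∫ z, G (x + ρ • z) ∂(stdGaussian E) := by
  have hpr : ∀ r : ℝ, IsProbabilityMeasure ((stdGaussian E).map (fun z => r • z)) := fun r =>
    Measure.isProbabilityMeasure_map (by fun_prop)
  have := hpr η
  have := hpr θ
  have hm : Measurable (fun z => G (x + z)) := by fun_prop
  have h1 := integral_map (μ := stdGaussian E) (φ := fun z : E => ρ • z) (by fun_prop)
    (f := fun z => G (x + z)) hm.aestronglyMeasurable
  rw [← h1, ← BL.conv_gauss η θ ρ h, integral_conv]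
  · rw [integral_map (by fun_prop)]
    · refine integral_congr_ae (Filter.Eventually.of_forall fun z => ?_)
      simp only
      rw [integral_map (by fun_prop)]
      · simp only [add_assoc]
      · exact Measurable.aestronglyMeasurable (by fun_prop)
    · refine StronglyMeasurable.aestronglyMeasurable ?_
      refine StronglyMeasurable.integral_prod_right' (f := fun p : E × E => G (x + (p.1 + p.2))) ?_
      exact Measurable.stronglyMeasurable (by fun_prop)
  · exact BL.integrable_of_bdd _ _ hm.aestronglyMeasurable C (fun _ => hC _)

lemma BL.Cls.avg {V : Submodule ℝ E} {c C K : ℝ} {G : E → ℝ} (hG : BL.Cls V c C K G) (η : ℝ) :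
    BL.Cls V c C K (fun x => ∫ z, G (x + η • z) ∂(stdGaussian E)) := by
  obtain ⟨hm, hb, w, hwm, hwV, hwK, hw⟩ := hG
  have hGb : ∀ x, ‖G x‖ ≤ max |c| |C| := fun x => abs_le_max_abs_abs (hb x).1 (hb x).2
  have hGi : ∀ x : E, Integrable (fun z => G (x + η • z)) (stdGaussian E) := fun x =>
    BL.integrable_of_bdd _ _ (Measurable.aestronglyMeasurable (by fun_prop)) _ (fun _ => hGb _)
  have hwi : ∀ x : E, Integrable (fun z => w (x + η • z)) (stdGaussian E) := fun x =>
    BL.integrable_of_bdd _ _ (Measurable.aestronglyMeasurable (by fun_prop)) _ (fun _ => hwK _)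
  refine ⟨?_, ?_, fun x => ∫ z, w (x + η • z) ∂(stdGaussian E), ?_, ?_, ?_, ?_⟩
  · refine StronglyMeasurable.measurable ?_
    exact StronglyMeasurable.integral_prod_right' (f := fun p : E × E => G (p.1 + η • p.2))
      (Measurable.stronglyMeasurable (by fun_prop))
  · intro x
    constructor
    · have := integral_mono (integrable_const c) (hGi x) (fun z => (hb _).1)
      simpa using this
    · have := integral_mono (hGi x) (integrable_const C) (fun z => (hb _).2)
      simpa using this
  · refine StronglyMeasurable.measurable ?_
    exact StronglyMeasurable.integral_prod_right' (f := fun p : E × E => w (p.1 + η • p.2))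
      (Measurable.stronglyMeasurable (by fun_prop))
  · intro x
    exact V.convex.integral_mem (V.closed_of_finiteDimensional)
      (Filter.Eventually.of_forall fun z => hwV _) (hwi x)
  · intro x
    have := norm_integral_le_of_norm_le_const (μ := stdGaussian E)
      (Filter.Eventually.of_forall fun z : E => hwK (x + η • z))
    simpa using this
  · intro x z
    have h1 : (∫ y, G (x + z + η • y) ∂(stdGaussian E)) - (∫ y, G (x + η • y) ∂(stdGaussian E))
        - inner ℝ (∫ y, w (x + η • y) ∂(stdGaussian E)) z =
        ∫ y, (G (x + z + η • y) - G (x + η • y) - inner ℝ (w (x + η • y)) z) ∂(stdGaussian E) := by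
      have h2 : inner ℝ (∫ y, w (x + η • y) ∂(stdGaussian E)) z =
          ∫ y, inner ℝ (w (x + η • y)) z ∂(stdGaussian E) := by
        rw [real_inner_comm, ← _root_.integral_inner (hwi x)]
        simp_rw [real_inner_comm]
      rw [h2, integral_sub, integral_sub (hGi _) (hGi _)]
      · exact (hGi _).sub (hGi _)
      · exact (hwi x).inner_const z
    rw [h1]
    have := norm_integral_le_of_norm_le_const (μ := stdGaussian E) (C := K * ‖z‖ ^ 2)
      (f := fun y => (G (x + z + η • y) - G (x + η • y) - inner ℝ (w (x + η • y)) z))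
      (Filter.Eventually.of_forall fun y : E => by
        have := hw (x + η • y) z
        rw [Real.norm_eq_abs]
        rwa [show x + z + η • y = x + η • y + z by abel])
    simpa using this

lemma BL.prod_bdd {ι : Type*} [Fintype ι] (q : ι → ℝ) (hq : ∀ i, 0 ≤ q i) {c C : ℝ} (hc : 0 < c)
    (g : ι → ℝ) (hg : ∀ i, c ≤ g i ∧ g i ≤ C) : ‖∏ i, g i ^ q i‖ ≤ ∏ i, C ^ q i := by
  have h0 : ∀ i, 0 ≤ g i := fun i => hc.le.trans (hg i).1
  rw [Real.norm_eq_abs, abs_of_nonneg (Finset.prod_nonneg fun i _ => Real.rpow_nonneg (h0 i) _)]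
  exact Finset.prod_le_prod (fun i _ => Real.rpow_nonneg (h0 i) _)
    fun i _ => Real.rpow_le_rpow (h0 i) (hg i).2 (hq i)

lemma BL.iter {ι : Type*} [Fintype ι] (q : ι → ℝ) (hq : ∀ i, 0 ≤ q i)
    (V : ι → Submodule ℝ E) (c C K : ℝ) (hc : 0 < c) (D η : ℝ) (hD : 0 ≤ D)
    (hstep : ∀ G : ι → E → ℝ, (∀ i, BL.Cls (V i) c C K (G i)) →
      ∀ x, ∫ z, ∏ i, G i (x + η • z) ^ q i ∂(stdGaussian E) ≤
        D * ∏ i, (∫ z, G i (x + η • z) ∂(stdGaussian E)) ^ q i) (k : ℕ) :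
    ∀ G : ι → E → ℝ, (∀ i, BL.Cls (V i) c C K (G i)) →
      ∀ x, ∫ z, ∏ i, G i (x + (√k * η) • z) ^ q i ∂(stdGaussian E) ≤
        D ^ k * ∏ i, (∫ z, G i (x + (√k * η) • z) ∂(stdGaussian E)) ^ q i := by
  induction k with
  | zero => intro G hG x; simp
  | succ k ih =>
    intro G hG x
    have hsq : (√(k:ℝ) * η) ^ 2 + η ^ 2 = (√((k + 1 : ℕ) : ℝ) * η) ^ 2 := by
      rw [mul_pow, mul_pow, Real.sq_sqrt (by positivity), Real.sq_sqrt (by positivity)]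
      push_cast; ring
    have hGm := fun i => (hG i).1
    have hPm : Measurable (fun x => ∏ i, G i x ^ q i) :=
      Finset.measurable_prod _ fun i _ => (hGm i).pow_const _
    have hb := fun x => BL.prod_bdd q hq hc (fun i => G i x) (fun i => (hG i).2.1 x)
    rw [← BL.semigroup _ _ _ hsq (fun x => ∏ i, G i x ^ q i) hPm _ hb]
    have hG' := fun i => (hG i).avg η
    have := ih _ hG' x
    have e : ∀ i, ∫ z, (∫ z', G i (x + (√(k:ℝ) * η) • z + η • z') ∂(stdGaussian E)) ∂(stdGaussian E)
        = ∫ z, G i (x + (√((k + 1 : ℕ) : ℝ) * η) • z) ∂(stdGaussian E) := fun i =>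
      BL.semigroup _ _ _ hsq (G i) (hGm i) (max |c| |C|)
        (fun x => abs_le_max_abs_abs ((hG i).2.1 x).1 ((hG i).2.1 x).2) x
    simp only [e] at this
    refine le_trans ?_ (b := D * (D ^ k * ∏ i, (∫ z, G i (x + (√((k + 1 : ℕ) : ℝ) * η) • z)
      ∂(stdGaussian E)) ^ q i)) ?_
    · refine le_trans ?_ (mul_le_mul_of_nonneg_left this hD)
      rw [← integral_const_mul]
      refine integral_mono ?_ ?_ ?_
      · refine BL.integrable_of_bdd _ _ ?_ (∏ i, C ^ q i) ?_
        · refine StronglyMeasurable.aestronglyMeasurable ?_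
          exact StronglyMeasurable.integral_prod_right'
            (f := fun p : E × E => ∏ i, G i (x + (√(k:ℝ) * η) • p.1 + η • p.2) ^ q i)
            (Measurable.stronglyMeasurable (hPm.comp (by fun_prop)))
        · intro z
          have := norm_integral_le_of_norm_le_const (μ := stdGaussian E)
            (Filter.Eventually.of_forall fun z' : E => hb (x + (√(k:ℝ) * η) • z + η • z'))
          simpa using this
      · refine Integrable.const_mul ?_ _
        refine BL.integrable_of_bdd _ _ ?_ (∏ i, C ^ q i) ?_
        · refine Measurable.aestronglyMeasurable ?_
          refine Finset.measurable_prod _ fun i _ => Measurable.pow_const ?_ _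
          exact (hG' i).1.comp (g := fun x => ∫ z, G i (x + η • z) ∂(stdGaussian E))
            (f := fun z => x + (√(k:ℝ) * η) • z) (by fun_prop)
        · intro z
          exact BL.prod_bdd q hq hc _ (fun i => (hG' i).2.1 (x + (√(k:ℝ) * η) • z))
      · intro z
        exact hstep G hG _
    · rw [pow_succ]; apply le_of_eq; ring

lemma BL.cls_ineq {ι : Type*} [Fintype ι] (q : ι → ℝ) (hq : ∀ i, 0 ≤ q i)
    (V : ι → Submodule ℝ E)
    (hV : ∀ w : ι → E, (∀ i, w i ∈ V i) → ‖∑ i, q i • w i‖ ^ 2 ≤ ∑ i, q i * ‖w i‖ ^ 2)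
    (c C K : ℝ) (hc : 0 < c) (hcC : c ≤ C) (hK : 0 ≤ K)
    (G : ι → E → ℝ) (hG : ∀ i, BL.Cls (V i) c C K (G i)) :
    ∫ z, ∏ i, G i z ^ q i ∂(stdGaussian E) ≤ ∏ i, (∫ z, G i z ∂(stdGaussian E)) ^ q i := by
  obtain ⟨K', hK', h⟩ := BL.one_step q hq V hV c C K hc hcC hK
  have key : ∀ N : ℕ, ∫ z, ∏ i, G i z ^ q i ∂(stdGaussian E) ≤
      Real.exp (K' * (1 / √((N + 1 : ℕ) : ℝ))) * ∏ i, (∫ z, G i z ∂(stdGaussian E)) ^ q i := by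
    intro N
    have hN : (1:ℝ) ≤ √((N + 1 : ℕ) : ℝ) := by
      rw [Real.one_le_sqrt]; push_cast; linarith [(Nat.cast_nonneg N : (0:ℝ) ≤ N)]
    have hN0 : (0:ℝ) < √((N + 1 : ℕ) : ℝ) := by linarith
    set η : ℝ := 1 / √((N + 1 : ℕ) : ℝ) with hη
    have hη0 : 0 < η := by positivity
    have hη1 : η ≤ 1 := by rw [hη, div_le_one hN0]; exact hN
    have := BL.iter q hq V c C K hc (1 + K' * η ^ 3) η (by positivity) (h η hη0 hη1) (N + 1) G hG 0
    have e : √((N + 1 : ℕ) : ℝ) * η = 1 := by rw [hη]; field_simp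
    simp only [e, one_smul, zero_add] at this
    refine this.trans (mul_le_mul_of_nonneg_right ?_ ?_)
    · calc (1 + K' * η ^ 3) ^ (N + 1) ≤ (Real.exp (K' * η ^ 3)) ^ (N + 1) := by
            refine pow_le_pow_left₀ (by positivity) ?_ _
            linarith [Real.add_one_le_exp (K' * η ^ 3)]
        _ = Real.exp (K' * η) := by
            rw [← Real.exp_nat_mul]
            congr 1
            have : ((N + 1 : ℕ) : ℝ) = √((N + 1 : ℕ) : ℝ) ^ 2 := by
              rw [Real.sq_sqrt (by positivity)]
            rw [this]
            calc √((N + 1 : ℕ) : ℝ) ^ 2 * (K' * η ^ 3) = K' * η * (√((N + 1 : ℕ) : ℝ) * η) ^ 2 := by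
                  ring
              _ = _ := by rw [e]; ring
    · refine Finset.prod_nonneg fun i _ => Real.rpow_nonneg (integral_nonneg fun z => ?_) _
      exact hc.le.trans ((hG i).2.1 z).1
  refine ge_of_tendsto' (f := fun N : ℕ => Real.exp (K' * (1 / √((N + 1 : ℕ) : ℝ))) * ∏ i, (∫ z, G i z ∂(stdGaussian E)) ^ q i)
    (x := Filter.atTop) ?_ key
  have t1 : Filter.Tendsto (fun N : ℕ => 1 / √((N + 1 : ℕ) : ℝ)) Filter.atTop (nhds 0) := by
    simp only [one_div]
    refine Filter.Tendsto.inv_tendsto_atTop ?_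
    exact Real.tendsto_sqrt_atTop.comp
      (tendsto_natCast_atTop_atTop.comp (Filter.tendsto_add_atTop_nat 1))
  have t2 := ((t1.const_mul K').rexp).mul_const (∏ i, (∫ z, G i z ∂(stdGaussian E)) ^ q i)
  simpa using t2

end iter

section ggi
open ProbabilityTheory
variable {E : Type*} [NormedAddCommGroup E] [InnerProductSpace ℝ E] [FiniteDimensional ℝ E]
  [MeasurableSpace E] [BorelSpace E]
variable {F : Type*} [NormedAddCommGroup F] [InnerProductSpace ℝ F] [FiniteDimensional ℝ F]
  [MeasurableSpace F] [BorelSpace F]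

lemma BL.Cls.mono {V : Submodule ℝ E} {c C K c' C' K' : ℝ} {G : E → ℝ} (hG : BL.Cls V c C K G)
    (h1 : c' ≤ c) (h2 : C ≤ C') (h3 : K ≤ K') : BL.Cls V c' C' K' G := by
  obtain ⟨hm, hb, w, hwm, hwV, hwK, hw⟩ := hG
  refine ⟨hm, fun x => ⟨h1.trans (hb x).1, (hb x).2.trans h2⟩, w, hwm, hwV,
    fun x => (hwK x).trans h3, fun x z => (hw x z).trans ?_⟩
  gcongr

lemma BL.Cls.comp {c C K : ℝ} (hK : 0 ≤ K) {G : F → ℝ} (hG : BL.Cls ⊤ c C K G) (B : E →L[ℝ] F)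
    (V : Submodule ℝ E) (hV : ∀ u, B.adjoint u ∈ V) :
    BL.Cls V c C (K * (1 + ‖B‖) ^ 2) (fun x => G (B x)) := by
  obtain ⟨hm, hb, w, hwm, hwV, hwK, hw⟩ := hG
  have hB := norm_nonneg B
  refine ⟨hm.comp B.measurable, fun x => hb _, fun x => B.adjoint (w (B x)), ?_, fun x => hV _, ?_, ?_⟩
  · exact B.adjoint.measurable.comp (hwm.comp B.measurable)
  · intro x
    calc ‖B.adjoint (w (B x))‖ ≤ ‖B.adjoint‖ * ‖w (B x)‖ := B.adjoint.le_opNorm _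
      _ ≤ ‖B‖ * K := by
        rw [LinearIsometryEquiv.norm_map]
        gcongr; exact hwK _
      _ ≤ K * (1 + ‖B‖) ^ 2 := by nlinarith [mul_nonneg hK hB, mul_nonneg hK (sq_nonneg ‖B‖)]
  · intro x z
    simp only []
    rw [map_add, ContinuousLinearMap.adjoint_inner_left]
    refine (hw _ _).trans ?_
    rw [mul_assoc, ← mul_pow]
    gcongr
    refine (B.le_opNorm z).trans ?_
    gcongr; linarith

lemma BL.cls_of_smooth (g : F → ℝ) (hg : HasCompactSupport g) (hs : ContDiff ℝ ((⊤ : ℕ∞) : WithTop ℕ∞) g) (ε : ℝ)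
    (hε : 0 < ε) : ∃ C K : ℝ, ε ≤ C ∧ 0 ≤ K ∧ BL.Cls ⊤ ε C K (fun x => √(g x ^ 2 + ε ^ 2)) := by
  set φ : F → ℝ := fun x => √(g x ^ 2 + ε ^ 2) with hφ
  set ψ : F → ℝ := fun x => φ x - ε with hψ
  have hφs : ContDiff ℝ ((⊤ : ℕ∞) : WithTop ℕ∞) φ := by
    refine ContDiff.sqrt (by fun_prop) (fun x => ?_)
    positivity
  have hψs : ContDiff ℝ ((⊤ : ℕ∞) : WithTop ℕ∞) ψ := by fun_prop
  have hψc : HasCompactSupport ψ := by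
    refine hg.mono' ?_
    refine (Function.support_subset_iff'.2 ?_).trans (subset_tsupport g)
    intro x hx
    simp only [Function.mem_support, not_not] at hx
    simp [hψ, hφ, hx, Real.sqrt_sq hε.le]
  have hfd : ∀ x, fderiv ℝ φ x = fderiv ℝ ψ x := fun x => by
    rw [hψ, fderiv_sub_const]
  obtain ⟨C0, hC0⟩ := hψc.exists_bound_of_continuous hψs.continuous
  have hψ1 : ContDiff ℝ 1 (fderiv ℝ ψ) := hψs.fderiv_right (by
    have : ((1 + 1 : ℕ∞) : WithTop ℕ∞) ≤ ((⊤ : ℕ∞) : WithTop ℕ∞) := WithTop.coe_le_coe.2 le_top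
    exact this)
  obtain ⟨C1, hC1⟩ := (hψc.fderiv (𝕜 := ℝ)).exists_bound_of_continuous hψ1.continuous
  obtain ⟨C2, hC2⟩ := ContDiff.lipschitzWith_of_hasCompactSupport (hψc.fderiv (𝕜 := ℝ)) hψ1 (by simp)
  have hC00 : 0 ≤ C0 := (norm_nonneg _).trans (hC0 0)
  have hC10 : 0 ≤ C1 := (norm_nonneg _).trans (hC1 0)
  refine ⟨ε + C0, C1 + C2, by linarith, by positivity, ?_, ?_,
    fun x => (InnerProductSpace.toDual ℝ F).symm (fderiv ℝ φ x), ?_, by simp, ?_, ?_⟩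
  · exact hφs.continuous.measurable
  · intro x
    constructor
    · exact Real.le_sqrt_of_sq_le (by nlinarith [sq_nonneg (g x)])
    · have := hC0 x
      have := le_abs_self (ψ x)
      simp only [Real.norm_eq_abs, hψ] at *
      linarith
  · refine Continuous.measurable ?_
    simp only [hfd]
    exact (LinearIsometryEquiv.continuous _).comp hψ1.continuous
  · intro x
    rw [LinearIsometryEquiv.norm_map, hfd]
    linarith [hC1 x, C2.2]
  · intro x z
    rw [InnerProductSpace.toDual_symm_apply]
    have := Convex.norm_image_sub_le_of_norm_fderiv_le' (𝕜 := ℝ) (f := φ) (φ := fderiv ℝ φ x)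
      (s := segment ℝ x (x + z)) (x := x) (y := x + z) (C := C2 * ‖z‖)
      (fun y _ => (hφs.differentiable (by simp)).differentiableAt)
      (fun y hy => by
        rw [hfd, hfd, ← dist_eq_norm]
        refine (hC2.dist_le_mul _ _).trans ?_
        gcongr
        rw [dist_eq_norm]
        have := norm_sub_le_of_mem_segment hy
        simpa using this)
      (convex_segment _ _) (left_mem_segment _ _ _) (right_mem_segment _ _ _)
    simp only [add_sub_cancel_left, Real.norm_eq_abs] at this
    refine this.trans ?_
    rw [mul_assoc, ← sq]
    gcongr
    linarith

lemma BL.approx (μ : Measure F) [IsProbabilityMeasure μ] (h : F → ℝ) (h0 : ∀ x, 0 ≤ h x)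
    (hm : Measurable h) (hi : Integrable h μ) :
    ∃ φ : ℕ → F → ℝ, (∀ k, ∃ c C K : ℝ, 0 < c ∧ c ≤ C ∧ 0 ≤ K ∧ BL.Cls ⊤ c C K (φ k)) ∧
      (∀ᵐ y ∂μ, Filter.Tendsto (fun k => φ k y) Filter.atTop (nhds (h y))) ∧
      Filter.Tendsto (fun k => ∫ y, φ k y ∂μ) Filter.atTop (nhds (∫ y, h y ∂μ)) := by
  have hL : MemLp h 1 μ := memLp_one_iff_integrable.2 hi
  have hε : ∀ k : ℕ, (0:ℝ) < 1 / ((k:ℝ) + 1) := fun k => by positivity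
  choose g hg1 hg2 hg3 using fun k : ℕ => hL.exist_eLpNorm_sub_le one_ne_top le_rfl (hε k)
  set φ : ℕ → F → ℝ := fun k x => √(g k x ^ 2 + (1 / ((k:ℝ) + 1)) ^ 2) with hφ
  have hφC : ∀ k : ℕ, ∃ C K : ℝ, 1 / ((k:ℝ) + 1) ≤ C ∧ 0 ≤ K ∧ BL.Cls ⊤ (1 / ((k:ℝ) + 1)) C K (φ k) :=
    fun k => BL.cls_of_smooth (g k) (hg1 k) (hg2 k) _ (hε k)
  have hφm : ∀ k, Measurable (φ k) := fun k => by
    obtain ⟨C, K, -, -, h⟩ := hφC k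
    exact h.1
  have hpt : ∀ k x, |φ k x - h x| ≤ |h x - g k x| + 1 / ((k:ℝ) + 1) := by
    intro k x
    have a1 : |g k x| ≤ φ k x := by
      rw [hφ, ← Real.sqrt_sq_eq_abs]
      exact Real.sqrt_le_sqrt (by nlinarith [sq_nonneg (1 / ((k:ℝ) + 1))])
    have a2 : φ k x ≤ |g k x| + 1 / ((k:ℝ) + 1) := by
      rw [hφ]
      apply Real.sqrt_le_iff.2
      constructor
      · positivity
      · nlinarith [sq_abs (g k x), mul_nonneg (abs_nonneg (g k x)) (hε k).le]
    have a3 := abs_sub_abs_le_abs_sub (h x) (g k x)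
    have a4 := abs_sub_abs_le_abs_sub (g k x) (h x)
    rw [abs_sub_comm (g k x) (h x)] at a4
    rw [abs_of_nonneg (h0 x)] at a3 a4
    rw [abs_le]; constructor <;> linarith
  have hbd : ∀ k, eLpNorm (φ k - h) 1 μ ≤ ENNReal.ofReal (2 * (1 / ((k:ℝ) + 1))) := by
    intro k
    calc eLpNorm (φ k - h) 1 μ ≤ eLpNorm (fun x => ‖(h - g k) x‖ + 1 / ((k:ℝ) + 1)) 1 μ := by
          refine eLpNorm_mono_real fun x => ?_
          exact hpt k x
      _ ≤ eLpNorm (fun x => ‖(h - g k) x‖) 1 μ + eLpNorm (fun x : F => 1 / ((k:ℝ) + 1)) 1 μ := by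
          refine eLpNorm_add_le ?_ ?_ le_rfl
          · exact (hm.sub (hg2 k).continuous.measurable).norm.aestronglyMeasurable
          · exact aestronglyMeasurable_const
      _ ≤ ENNReal.ofReal (1 / ((k:ℝ) + 1)) + ENNReal.ofReal (1 / ((k:ℝ) + 1)) := by
          rw [eLpNorm_norm]
          gcongr
          · exact hg3 k
          · rw [eLpNorm_const _ one_ne_zero (IsProbabilityMeasure.ne_zero μ)]
            simp only [measure_univ, ENNReal.one_rpow, mul_one]
            rw [Real.enorm_eq_ofReal (hε k).le]
      _ = _ := by rw [← ENNReal.ofReal_add (hε k).le (hε k).le, two_mul]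
  have ht : Filter.Tendsto (fun k => eLpNorm (φ k - h) 1 μ) Filter.atTop (nhds 0) := by
    refine tendsto_of_tendsto_of_tendsto_of_le_of_le tendsto_const_nhds ?_ (fun _ => zero_le) hbd
    have : Filter.Tendsto (fun k : ℕ => 2 * (1 / ((k:ℝ) + 1))) Filter.atTop (nhds 0) := by
      simpa using (tendsto_one_div_add_atTop_nhds_zero_nat (𝕜 := ℝ)).const_mul 2
    simpa using ENNReal.tendsto_ofReal this
  obtain ⟨ns, hns, hae⟩ := (tendstoInMeasure_of_tendsto_eLpNorm one_ne_zero
    (fun k => (hφm k).aestronglyMeasurable) hm.aestronglyMeasurable ht).exists_seq_tendsto_ae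
  refine ⟨fun k => φ (ns k), fun k => ?_, hae, ?_⟩
  · obtain ⟨C, K, h1, h2, h3⟩ := hφC (ns k)
    exact ⟨_, C, K, hε _, h1, h2, h3⟩
  · have := tendsto_integral_of_L1' h hi.aestronglyMeasurable (F := φ) (l := Filter.atTop)
      (Filter.Eventually.of_forall fun k => ?_) ht
    · exact this.comp hns.tendsto_atTop
    · obtain ⟨C, K, h1, h2, h3⟩ := hφC k
      exact BL.integrable_of_bdd _ _ (hφm k).aestronglyMeasurable C (fun x => by
        rw [Real.norm_eq_abs, abs_of_nonneg ((hε k).le.trans (h3.2.1 x).1)]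
        exact (h3.2.1 x).2)

lemma BL.map_gauss (B : E →L[ℝ] F) (hB : ∀ u, B (B.adjoint u) = u) :
    (stdGaussian E).map B = stdGaussian F := by
  have : IsProbabilityMeasure ((stdGaussian E).map B) :=
    Measure.isProbabilityMeasure_map (by fun_prop)
  refine Measure.ext_of_charFun ?_
  ext t
  have h1 : charFun ((stdGaussian E).map B) t = charFun (stdGaussian E) (B.adjoint t) := by
    rw [charFun_apply, charFun_apply, integral_map (by fun_prop)
      (Continuous.aestronglyMeasurable (by fun_prop))]
    simp only [ContinuousLinearMap.adjoint_inner_right]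
  have h2 : ‖B.adjoint t‖ ^ 2 = ‖t‖ ^ 2 := by
    rw [← real_inner_self_eq_norm_sq, ContinuousLinearMap.adjoint_inner_left, hB,
      real_inner_self_eq_norm_sq]
  rw [h1, charFun_stdGaussian, charFun_stdGaussian]
  norm_cast
  rw [h2]

/-- The Gaussian form of the geometric Brascamp-Lieb inequality. -/
lemma BL.ggi {ι : Type*} [Fintype ι] (q : ι → ℝ) (hq : ∀ i, 0 ≤ q i)
    {F : ι → Type*} [∀ i, NormedAddCommGroup (F i)] [∀ i, InnerProductSpace ℝ (F i)]
    [∀ i, FiniteDimensional ℝ (F i)] [∀ i, MeasurableSpace (F i)] [∀ i, BorelSpace (F i)]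
    (B : ∀ i, E →L[ℝ] F i) (hB : ∀ i u, B i ((B i).adjoint u) = u)
    (hS : ∀ v, ∑ i, q i * ‖B i v‖ ^ 2 ≤ ‖v‖ ^ 2)
    (h : ∀ i, F i → ℝ≥0∞) (hm : ∀ i, Measurable (h i))
    (hfin : ∀ i, ∫⁻ y, h i y ∂(stdGaussian (F i)) ≠ ⊤) :
    ∫⁻ z, ∏ i, (h i (B i z)) ^ q i ∂(stdGaussian E) ≤
      ∏ i, (∫⁻ y, h i y ∂(stdGaussian (F i))) ^ q i := by
  set h' : ∀ i, F i → ℝ := fun i y => (h i y).toReal with hh'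
  have hh0 : ∀ i y, 0 ≤ h' i y := fun i y => toReal_nonneg
  have hh'm : ∀ i, Measurable (h' i) := fun i => (hm i).ennreal_toReal
  have hh'i : ∀ i, Integrable (h' i) (stdGaussian (F i)) := fun i =>
    integrable_toReal_of_lintegral_ne_top (hm i).aemeasurable (hfin i)
  have hae : ∀ i, ∀ᵐ y ∂(stdGaussian (F i)), h i y < ⊤ := fun i =>
    ae_lt_top (hm i) (hfin i)
  have hintEq : ∀ i, ∫⁻ y, h i y ∂(stdGaussian (F i)) =
      ENNReal.ofReal (∫ y, h' i y ∂(stdGaussian (F i))) := fun i => by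
    rw [integral_toReal (hm i).aemeasurable (hae i), ofReal_toReal (hfin i)]
  choose φ hφ1 hφ2 hφ3 using fun i => BL.approx (stdGaussian (F i)) (h' i) (hh0 i) (hh'm i) (hh'i i)
  set V : ι → Submodule ℝ E := fun i => LinearMap.range ((B i).adjoint : F i →ₗ[ℝ] E) with hVdef
  have hVm : ∀ i u, (B i).adjoint u ∈ V i := fun i u => ⟨u, rfl⟩
  have hV : ∀ w : ι → E, (∀ i, w i ∈ V i) → ‖∑ i, q i • w i‖ ^ 2 ≤ ∑ i, q i * ‖w i‖ ^ 2 := by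
    intro w hw
    choose u hu using hw
    have hu : ∀ i, w i = (B i).adjoint (u i) := fun i => (hu i).symm
    have hn : ∀ i, ‖w i‖ ^ 2 = ‖u i‖ ^ 2 := fun i => by
      rw [hu, ← real_inner_self_eq_norm_sq, ContinuousLinearMap.adjoint_inner_left, hB,
        real_inner_self_eq_norm_sq]
    set v := ∑ i, q i • w i with hv
    have h1 : ‖v‖ ^ 2 = ∑ i, q i * inner ℝ (u i) (B i v) := by
      rw [← real_inner_self_eq_norm_sq]
      conv_lhs => enter [2]; rw [hv]
      rw [sum_inner]
      refine Finset.sum_congr rfl fun i _ => ?_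
      rw [real_inner_smul_left, hu, ContinuousLinearMap.adjoint_inner_left]
    have h2 : ∑ i, q i * inner ℝ (u i) (B i v) ≤
        ∑ i, q i * ((‖u i‖ ^ 2 + ‖B i v‖ ^ 2) / 2) := by
      refine Finset.sum_le_sum fun i _ => mul_le_mul_of_nonneg_left ?_ (hq i)
      have := real_inner_le_norm (u i) (B i v)
      nlinarith [sq_nonneg (‖u i‖ - ‖B i v‖)]
    have h3 : ∑ i, q i * ((‖u i‖ ^ 2 + ‖B i v‖ ^ 2) / 2) =
        (∑ i, q i * ‖w i‖ ^ 2) / 2 + (∑ i, q i * ‖B i v‖ ^ 2) / 2 := by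
      rw [Finset.sum_div, Finset.sum_div, ← Finset.sum_add_distrib]
      refine Finset.sum_congr rfl fun i _ => ?_
      rw [hn]; ring
    linarith [hS v]
  have hBm : ∀ i, MeasurePreserving (B i) (stdGaussian E) (stdGaussian (F i)) := fun i =>
    ⟨(B i).measurable, BL.map_gauss (B i) (hB i)⟩
  -- inequality for approximants
  have key : ∀ k, ∫⁻ z, ENNReal.ofReal (∏ i, (φ i k (B i z)) ^ q i) ∂(stdGaussian E) ≤
      ENNReal.ofReal (∏ i, (∫ y, φ i k y ∂(stdGaussian (F i))) ^ q i) := by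
    intro k
    choose c C K hc hcC hK hcls using fun i => hφ1 i k
    have hcls' := fun i => (hcls i).comp (hK i) (B i) (V i) (hVm i)
    obtain ⟨c0, hc0, hc0'⟩ : ∃ c0 : ℝ, 0 < c0 ∧ ∀ i, c0 ≤ c i := by
      rcases isEmpty_or_nonempty ι with hι | hι
      · exact ⟨1, one_pos, fun i => isEmptyElim i⟩
      · obtain ⟨i0, hi0⟩ := Finite.exists_min c
        exact ⟨c i0, hc i0, hi0⟩
    set C0 := c0 + ∑ i, C i with hC0
    have hC00 : ∀ i, C i ≤ C0 := fun i => by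
      have := Finset.single_le_sum (f := C) (fun j _ => (hc j).le.trans (hcC j)) (Finset.mem_univ i)
      linarith
    set K0 := ∑ i, K i * (1 + ‖B i‖) ^ 2 with hK0
    have hKn : ∀ i, 0 ≤ K i * (1 + ‖B i‖) ^ 2 := fun i => mul_nonneg (hK i) (by positivity)
    have hK00 : ∀ i, K i * (1 + ‖B i‖) ^ 2 ≤ K0 := fun i =>
      Finset.single_le_sum (f := fun i => K i * (1 + ‖B i‖) ^ 2) (fun j _ => hKn j) (Finset.mem_univ i)
    have hcls'' := fun i => (hcls' i).mono (hc0' i) (hC00 i) (hK00 i)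
    have := BL.cls_ineq q hq V hV c0 C0 K0 hc0
      (by have : 0 ≤ ∑ i, C i := Finset.sum_nonneg fun i _ => (hc i).le.trans (hcC i)
          linarith) (Finset.sum_nonneg fun i _ => hKn i) _ hcls''
    have e : ∀ i, ∫ z, φ i k (B i z) ∂(stdGaussian E) = ∫ y, φ i k y ∂(stdGaussian (F i)) := by
      intro i
      rw [← (hBm i).map_eq, integral_map (hBm i).aemeasurable]
      exact (hcls i).1.aestronglyMeasurable
    simp only [e] at this
    rw [← ofReal_integral_eq_lintegral_ofReal]
    · exact ENNReal.ofReal_le_ofReal this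
    · refine BL.integrable_of_bdd _ _ (Measurable.aestronglyMeasurable ?_) (∏ i, C0 ^ q i) ?_
      · exact Finset.measurable_prod _ fun i _ => (hcls'' i).1.pow_const _
      · intro z
        exact BL.prod_bdd q hq hc0 _ fun i => (hcls'' i).2.1 z
    · refine Filter.Eventually.of_forall fun z => Finset.prod_nonneg fun i _ => Real.rpow_nonneg ?_ _
      exact hc0.le.trans ((hcls'' i).2.1 z).1
  have hφm : ∀ i k, Measurable (φ i k) := fun i k => by
    obtain ⟨c, C, K, -, -, -, h⟩ := hφ1 i k
    exact h.1
  have lim1 : ∀ᵐ z ∂(stdGaussian E), Filter.Tendsto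
      (fun k => ENNReal.ofReal (∏ i, (φ i k (B i z)) ^ q i)) Filter.atTop
      (nhds (∏ i, (h i (B i z)) ^ q i)) := by
    have a1 : ∀ᵐ z ∂(stdGaussian E), ∀ i, Filter.Tendsto (fun k => φ i k (B i z)) Filter.atTop
        (nhds (h' i (B i z))) :=
      ae_all_iff.2 fun i => (hBm i).quasiMeasurePreserving.ae (hφ2 i)
    have a2 : ∀ᵐ z ∂(stdGaussian E), ∀ i, h i (B i z) < ⊤ :=
      ae_all_iff.2 fun i => (hBm i).quasiMeasurePreserving.ae (hae i)
    filter_upwards [a1, a2] with z h1 h2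
    have : ∏ i, (h i (B i z)) ^ q i = ENNReal.ofReal (∏ i, (h' i (B i z)) ^ q i) := by
      rw [ENNReal.ofReal_prod_of_nonneg fun i _ => Real.rpow_nonneg (hh0 i _) _]
      refine Finset.prod_congr rfl fun i _ => ?_
      rw [← ENNReal.ofReal_rpow_of_nonneg (hh0 i _) (hq i), hh', ofReal_toReal (h2 i).ne]
    rw [this]
    refine ENNReal.tendsto_ofReal (tendsto_finsetProd _ fun i _ => ?_)
    exact (h1 i).rpow_const (Or.inr (hq i))
  have lim2 : Filter.Tendsto
      (fun k => ENNReal.ofReal (∏ i, (∫ y, φ i k y ∂(stdGaussian (F i))) ^ q i)) Filter.atTop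
      (nhds (∏ i, (∫⁻ y, h i y ∂(stdGaussian (F i))) ^ q i)) := by
    have : ∏ i, (∫⁻ y, h i y ∂(stdGaussian (F i))) ^ q i =
        ENNReal.ofReal (∏ i, (∫ y, h' i y ∂(stdGaussian (F i))) ^ q i) := by
      have hn : ∀ i, 0 ≤ ∫ y, h' i y ∂(stdGaussian (F i)) := fun i => integral_nonneg (hh0 i)
      rw [ENNReal.ofReal_prod_of_nonneg fun i _ => Real.rpow_nonneg (hn i) _]
      refine Finset.prod_congr rfl fun i _ => ?_
      rw [← ENNReal.ofReal_rpow_of_nonneg (hn i) (hq i), hintEq]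
    rw [this]
    refine ENNReal.tendsto_ofReal (tendsto_finsetProd _ fun i _ => ?_)
    exact (hφ3 i).rpow_const (Or.inr (hq i))
  calc ∫⁻ z, ∏ i, (h i (B i z)) ^ q i ∂(stdGaussian E)
      = ∫⁻ z, Filter.liminf (fun k => ENNReal.ofReal (∏ i, (φ i k (B i z)) ^ q i)) Filter.atTop
          ∂(stdGaussian E) := by
        refine lintegral_congr_ae ?_
        filter_upwards [lim1] with z hz
        exact hz.liminf_eq.symm
    _ ≤ Filter.liminf (fun k => ∫⁻ z, ENNReal.ofReal (∏ i, (φ i k (B i z)) ^ q i)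
          ∂(stdGaussian E)) Filter.atTop := by
        refine lintegral_liminf_le fun k => ?_
        refine Measurable.ennreal_ofReal ?_
        exact Finset.measurable_prod _ fun i _ =>
          Measurable.pow_const ((hφm i k).comp (B i).measurable) _
    _ ≤ Filter.liminf (fun k => ENNReal.ofReal (∏ i, (∫ y, φ i k y ∂(stdGaussian (F i))) ^ q i))
          Filter.atTop := Filter.liminf_le_liminf (Filter.Eventually.of_forall key)
    _ = _ := lim2.liminf_eq

end ggi

section gauss
open ProbabilityTheory

lemma BL.pi_gaussian (n : ℕ) : Measure.pi (fun _ : Fin n => gaussianReal 0 1) =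
    (volume : Measure (Fin n → ℝ)).withDensity
      (fun x => ENNReal.ofReal (∏ i, gaussianPDFReal 0 1 (x i))) := by
  refine Measure.pi_eq fun s hs => ?_
  rw [withDensity_apply _ (MeasurableSet.univ_pi hs), volume_pi, Measure.restrict_pi_pi]
  rw [← ofReal_integral_eq_lintegral_ofReal]
  · rw [integral_fintype_prod_eq_prod (𝕜 := ℝ) (fun _ => gaussianPDFReal 0 1),
      ENNReal.ofReal_prod_of_nonneg]
    · refine Finset.prod_congr rfl fun i _ => ?_
      rw [gaussianReal_apply_eq_integral 0 one_ne_zero]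
    · intro i _
      exact integral_nonneg fun x => gaussianPDFReal_nonneg _ _ _
  · refine Integrable.fintype_prod (f := fun _ => gaussianPDFReal 0 1) fun i => ?_
    exact (integrable_gaussianPDFReal 0 1).restrict
  · exact Filter.Eventually.of_forall fun x => Finset.prod_nonneg fun i _ =>
      gaussianPDFReal_nonneg _ _ _

lemma BL.prod_pdf (n : ℕ) (x : Fin n → ℝ) : ∏ i, gaussianPDFReal 0 1 (x i) =
    (√(2 * Real.pi) ^ n)⁻¹ * Real.exp (-(x ⬝ᵥ x) / 2) := by
  simp only [gaussianPDFReal_def, NNReal.coe_one, mul_one, sub_zero]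
  rw [Finset.prod_mul_distrib, ← Real.exp_sum]
  simp only [Finset.prod_const, Finset.card_univ, Fintype.card_fin, inv_pow]
  simp [dotProduct, Finset.sum_div, neg_div, sq]

lemma BL.lintegral_gauss {n : ℕ} (h : (Fin n → ℝ) → ℝ≥0∞) (hm : Measurable h) :
    ∫⁻ z, h z.ofLp ∂(stdGaussian (EuclideanSpace ℝ (Fin n))) =
      ∫⁻ x : Fin n → ℝ, h x * ENNReal.ofReal ((√(2 * Real.pi) ^ n)⁻¹ * Real.exp (-(x ⬝ᵥ x) / 2)) := by
  rw [← map_pi_eq_stdGaussian, lintegral_map (by fun_prop) (by fun_prop), BL.pi_gaussian]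
  simp only [BL.prod_pdf]
  rw [lintegral_withDensity_eq_lintegral_mul _ _ hm]
  · refine lintegral_congr fun x => ?_
    simp [mul_comm]
  · refine Measurable.ennreal_ofReal ?_
    refine Continuous.measurable ?_
    unfold dotProduct
    fun_prop

lemma BL.lintegral_mulVec {n : ℕ} (P : Matrix (Fin n) (Fin n) ℝ) (hP : P.det ≠ 0)
    (g : (Fin n → ℝ) → ℝ≥0∞) (hg : Measurable g) :
    ∫⁻ x, g x = ENNReal.ofReal |P.det| * ∫⁻ y, g (P.mulVec y) := by
  have h1 := Real.map_matrix_volume_pi_eq_smul_volume_pi hP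
  have h2 : ∫⁻ y, g (P.mulVec y) = ∫⁻ x, g x ∂(Measure.map (toLin' P) volume) := by
    rw [lintegral_map hg]
    · simp
    · exact (LinearMap.continuous_of_finiteDimensional _).measurable
  rw [h2, h1, lintegral_smul_measure, smul_eq_mul, ← mul_assoc, ← ENNReal.ofReal_mul (abs_nonneg _),
    ← abs_mul, mul_inv_cancel₀ hP]
  simp

lemma BL.gauss_cov {n : ℕ} (P M : Matrix (Fin n) (Fin n) ℝ) (hM : M.PosDef)
    (hP : Pᵀ * P = (2 * Real.pi) • M) (h : (Fin n → ℝ) → ℝ≥0∞) (hm : Measurable h) :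
    ∫⁻ z, h z.ofLp ∂(stdGaussian (EuclideanSpace ℝ (Fin n))) =
      ENNReal.ofReal √M.det *
        ∫⁻ y : Fin n → ℝ, h (P.mulVec y) * ENNReal.ofReal (Real.exp (-Real.pi * (y ⬝ᵥ M.mulVec y))) := by
  have hpi := Real.pi_pos
  have hdet : P.det ^ 2 = (2 * Real.pi) ^ n * M.det := by
    have := congrArg Matrix.det hP
    rw [det_mul, det_transpose, det_smul, Fintype.card_fin] at this
    rw [sq, this]
  have hMd := hM.det_pos
  have hP0 : P.det ≠ 0 := by
    intro h0
    rw [h0] at hdet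
    have : 0 < (2 * Real.pi) ^ n * M.det := by positivity
    rw [← hdet] at this
    norm_num at this
  have hPabs : |P.det| = √(2 * Real.pi) ^ n * √M.det := by
    rw [← Real.sqrt_sq_eq_abs, hdet, Real.sqrt_mul (by positivity)]
    congr 1
    rw [Real.sqrt_eq_iff_mul_self_eq (by positivity) (by positivity), ← mul_pow,
      Real.mul_self_sqrt (by positivity)]
  have hq : ∀ y, P.mulVec y ⬝ᵥ P.mulVec y = 2 * Real.pi * (y ⬝ᵥ M.mulVec y) := by
    intro y
    rw [dotProduct_mulVec, ← mulVec_transpose, mulVec_mulVec, hP, smul_mulVec, smul_dotProduct,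
      dotProduct_comm, smul_eq_mul]
  rw [BL.lintegral_gauss h hm, BL.lintegral_mulVec P hP0]
  · rw [← lintegral_const_mul', ← lintegral_const_mul' _ _ ofReal_ne_top]
    · refine lintegral_congr fun y => ?_
      rw [hq, hPabs, mul_left_comm, mul_left_comm (ENNReal.ofReal √M.det),
        ← ENNReal.ofReal_mul (by positivity), ← ENNReal.ofReal_mul (by positivity)]
      congr 2
      have : √(2 * Real.pi) ^ n ≠ 0 := by positivity
      field_simp
    · exact ofReal_ne_top
  · refine hm.mul (Measurable.ennreal_ofReal (Continuous.measurable ?_))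
    unfold dotProduct
    fun_prop

open scoped MatrixOrder Matrix.Norms.L2Operator in
lemma BL.exists_sqrt {n : ℕ} (M : Matrix (Fin n) (Fin n) ℝ) (hM : M.PosDef) :
    ∃ P : Matrix (Fin n) (Fin n) ℝ, Pᵀ * P = (2 * Real.pi) • M ∧ IsUnit P.det := by
  have h2 : ((2 * Real.pi) • M).PosDef := hM.smul (by positivity)
  obtain ⟨P, hP⟩ := CStarAlgebra.nonneg_iff_eq_star_mul_self.mp h2.posSemidef.nonneg
  rw [star_eq_conjTranspose, conjTranspose_eq_transpose_of_trivial] at hP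
  refine ⟨P, hP.symm, isUnit_iff_ne_zero.2 fun h => ?_⟩
  have := h2.det_pos
  rw [hP, det_mul, h] at this
  simp at this

/-- The Gaussian integral. -/
lemma BL.gauss_int {n : ℕ} (M : Matrix (Fin n) (Fin n) ℝ) (hM : M.PosDef) :
    ∫⁻ y : Fin n → ℝ, ENNReal.ofReal (Real.exp (-Real.pi * (y ⬝ᵥ M.mulVec y))) =
      (ENNReal.ofReal √M.det)⁻¹ := by
  obtain ⟨P, hP, -⟩ := BL.exists_sqrt M hM
  have := BL.gauss_cov P M hM hP (fun _ => 1) measurable_const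
  simp only [lintegral_const, measure_univ, one_mul, mul_one] at this
  exact ENNReal.eq_inv_of_mul_eq_one_left (by rw [mul_comm]; exact this.symm)

end gauss

section weighted
open ProbabilityTheory

noncomputable def BL.clm {a b : ℕ} (A : Matrix (Fin a) (Fin b) ℝ) :
    EuclideanSpace ℝ (Fin b) →L[ℝ] EuclideanSpace ℝ (Fin a) :=
  LinearMap.toContinuousLinearMap (Matrix.toEuclideanLin A)

lemma BL.clm_ofLp {a b : ℕ} (A : Matrix (Fin a) (Fin b) ℝ) (x : EuclideanSpace ℝ (Fin b)) :
    (BL.clm A x).ofLp = A.mulVec x.ofLp := by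
  simp [BL.clm]

lemma BL.inner_eq {a : ℕ} (x y : EuclideanSpace ℝ (Fin a)) : inner ℝ x y = x.ofLp ⬝ᵥ y.ofLp := by
  rw [EuclideanSpace.inner_eq_star_dotProduct, dotProduct_comm]; simp

lemma BL.clm_adjoint {a b : ℕ} (A : Matrix (Fin a) (Fin b) ℝ) :
    (BL.clm A).adjoint = BL.clm Aᵀ := by
  symm
  rw [ContinuousLinearMap.eq_adjoint_iff]
  intro x y
  rw [BL.inner_eq, BL.inner_eq, BL.clm_ofLp, BL.clm_ofLp, mulVec_transpose, ← dotProduct_mulVec]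

lemma BL.clm_norm {a b : ℕ} (A : Matrix (Fin a) (Fin b) ℝ) (v : EuclideanSpace ℝ (Fin b)) :
    ‖BL.clm A v‖ ^ 2 = v.ofLp ⬝ᵥ (Aᵀ * A).mulVec v.ofLp := by
  rw [← real_inner_self_eq_norm_sq, BL.inner_eq, BL.clm_ofLp, ← mulVec_mulVec, dotProduct_mulVec v.ofLp,
    vecMul_transpose]

lemma BL.quad {a : ℕ} (Q A : Matrix (Fin a) (Fin a) ℝ) (c : ℝ) (h : Qᵀ * Q = c • A)
    (y : Fin a → ℝ) : Q.mulVec y ⬝ᵥ Q.mulVec y = c * (y ⬝ᵥ A.mulVec y) := by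
  rw [dotProduct_mulVec, ← mulVec_transpose, mulVec_mulVec, h, smul_mulVec, smul_dotProduct,
      dotProduct_comm, smul_eq_mul]

lemma BL.quad_L {a b : ℕ} (L : Matrix (Fin a) (Fin b) ℝ) (A : Matrix (Fin a) (Fin a) ℝ)
    (y : Fin b → ℝ) : y ⬝ᵥ (Lᵀ * A * L).mulVec y = L.mulVec y ⬝ᵥ A.mulVec (L.mulVec y) := by
  rw [← mulVec_mulVec, ← mulVec_mulVec, dotProduct_mulVec, vecMul_transpose]

lemma BL.quad_M {ι : Type*} [Fintype ι] {n : ℕ} {ni : ι → ℕ}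
    (L : ∀ i, Matrix (Fin (ni i)) (Fin n) ℝ) (q : ι → ℝ) (δ : ℝ)
    (A : ∀ i, Matrix (Fin (ni i)) (Fin (ni i)) ℝ) (y : Fin n → ℝ) :
    y ⬝ᵥ (δ • (1 : Matrix (Fin n) (Fin n) ℝ) + ∑ i, q i • ((L i)ᵀ * A i * L i)).mulVec y =
      δ * (y ⬝ᵥ y) + ∑ i, q i * ((L i).mulVec y ⬝ᵥ (A i).mulVec ((L i).mulVec y)) := by
  rw [add_mulVec, dotProduct_add, smul_mulVec, one_mulVec, dotProduct_smul, smul_eq_mul,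
    sum_mulVec, dotProduct_sum]
  congr 1
  refine Finset.sum_congr rfl fun i _ => ?_
  rw [smul_mulVec, dotProduct_smul, BL.quad_L, smul_eq_mul]

lemma BL.inv_fact {a : ℕ} (Q A : Matrix (Fin a) (Fin a) ℝ) (c : ℝ) (hc : c ≠ 0) (hA : A.PosDef)
    (h : Qᵀ * Q = c • A) : Q⁻¹ * (Q⁻¹)ᵀ = c⁻¹ • A⁻¹ := by
  have hu : IsUnit A.det := isUnit_iff_ne_zero.2 hA.det_pos.ne'
  rw [transpose_nonsing_inv, ← Matrix.mul_inv_rev, h]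
  apply Matrix.inv_eq_right_inv
  rw [smul_mul_smul_comm, Matrix.mul_nonsing_inv _ hu, mul_inv_cancel₀ hc, one_smul]

lemma BL.weighted {ι : Type*} [Fintype ι] {n : ℕ} {ni : ι → ℕ}
    (L : ∀ i, Matrix (Fin (ni i)) (Fin n) ℝ) (q : ι → ℝ) (hq : ∀ i, 0 ≤ q i) (δ : ℝ) (hδ : 0 ≤ δ)
    (A : ∀ i, Matrix (Fin (ni i)) (Fin (ni i)) ℝ) (hA : ∀ i, (A i).PosDef)
    (M : Matrix (Fin n) (Fin n) ℝ) (hM : M.PosDef)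
    (hMeq : M = δ • (1 : Matrix (Fin n) (Fin n) ℝ) + ∑ i, q i • ((L i)ᵀ * A i * L i))
    (hcrit : ∀ i, L i * M⁻¹ * (L i)ᵀ = (A i)⁻¹)
    (f : ∀ i, (Fin (ni i) → ℝ) → ℝ≥0∞) (hf : ∀ i, Measurable (f i))
    (hfin : ∀ i, ∫⁻ y, f i y ≠ ⊤) :
    ENNReal.ofReal √M.det * ∫⁻ x : Fin n → ℝ, (∏ i, (f i ((L i).mulVec x)) ^ q i) *
        ENNReal.ofReal (Real.exp (-Real.pi * (δ * (x ⬝ᵥ x)))) ≤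
      ENNReal.ofReal (√(∏ i, (A i).det ^ q i)) * ∏ i, (∫⁻ y, f i y) ^ q i := by
  have hpi := Real.pi_pos
  obtain ⟨P, hP, hPu⟩ := BL.exists_sqrt M hM
  choose Q hQ hQu using fun i => BL.exists_sqrt (A i) (hA i)
  have h2pi : (2 * Real.pi) ≠ 0 := by positivity
  have hPinv := BL.inv_fact P M _ h2pi hM hP
  have hQinv := fun i => BL.inv_fact (Q i) (A i) _ h2pi (hA i) (hQ i)
  set W : ∀ i, Matrix (Fin (ni i)) (Fin n) ℝ := fun i => Q i * L i * P⁻¹ with hW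
  have hWW : ∀ i, W i * (W i)ᵀ = 1 := by
    intro i
    have e1 : W i * (W i)ᵀ = Q i * (L i * (P⁻¹ * (P⁻¹)ᵀ) * (L i)ᵀ) * (Q i)ᵀ := by
      simp only [hW, transpose_mul, Matrix.mul_assoc]
    have e2 : (2 * Real.pi)⁻¹ • (A i)⁻¹ = (Q i)⁻¹ * ((Q i)⁻¹)ᵀ := (hQinv i).symm
    rw [e1, hPinv, Matrix.mul_smul, Matrix.smul_mul, hcrit, e2, ← Matrix.mul_assoc,
      Matrix.mul_nonsing_inv _ (hQu i), Matrix.one_mul, ← transpose_mul,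
      Matrix.mul_nonsing_inv _ (hQu i), transpose_one]
  set h : ∀ i, EuclideanSpace ℝ (Fin (ni i)) → ℝ≥0∞ := fun i z =>
    f i ((Q i)⁻¹.mulVec z.ofLp) * ENNReal.ofReal (Real.exp (Real.pi *
      ((Q i)⁻¹.mulVec z.ofLp ⬝ᵥ (A i).mulVec ((Q i)⁻¹.mulVec z.ofLp)))) with hh
  have hhm' : ∀ i, Measurable (fun y : Fin (ni i) → ℝ => f i ((Q i)⁻¹.mulVec y) *
      ENNReal.ofReal (Real.exp (Real.pi *
      ((Q i)⁻¹.mulVec y ⬝ᵥ (A i).mulVec ((Q i)⁻¹.mulVec y))))) := by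
    intro i
    refine Measurable.mul ((hf i).comp (Continuous.measurable (by fun_prop))) ?_
    refine Measurable.ennreal_ofReal (Continuous.measurable ?_)
    unfold dotProduct
    fun_prop
  have hhm : ∀ i, Measurable (h i) := fun i => (hhm' i).comp (by fun_prop)
  have hQQ : ∀ i y, (Q i)⁻¹.mulVec ((Q i).mulVec y) = y := fun i y => by
    rw [mulVec_mulVec, Matrix.nonsing_inv_mul _ (hQu i), one_mulVec]
  have hPP : ∀ y, P⁻¹.mulVec (P.mulVec y) = y := fun y => by
    rw [mulVec_mulVec, Matrix.nonsing_inv_mul _ hPu, one_mulVec]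
  have hPP' : ∀ y, P.mulVec (P⁻¹.mulVec y) = y := fun y => by
    rw [mulVec_mulVec, Matrix.mul_nonsing_inv _ hPu, one_mulVec]
  have hhintEq : ∀ i, ∫⁻ z, h i z ∂(stdGaussian (EuclideanSpace ℝ (Fin (ni i)))) =
      ENNReal.ofReal √(A i).det * ∫⁻ y, f i y := by
    intro i
    have := BL.gauss_cov (Q i) (A i) (hA i) (hQ i) _ (hhm' i)
    simp only [hh]
    rw [this]
    congr 1
    refine lintegral_congr fun y => ?_
    rw [hQQ, mul_assoc, ← ENNReal.ofReal_mul (by positivity), ← Real.exp_add]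
    simp
  have hG := BL.ggi q hq (E := EuclideanSpace ℝ (Fin n)) (F := fun i => EuclideanSpace ℝ (Fin (ni i)))
    (fun i => BL.clm (W i))
    (by
      intro i u
      rw [BL.clm_adjoint]
      ext1
      rw [BL.clm_ofLp, BL.clm_ofLp, mulVec_mulVec, hWW, one_mulVec])
    (by
      intro v
      have e1 : ∀ i, ‖BL.clm (W i) v‖ ^ 2 = 2 * Real.pi *
          ((L i).mulVec (P⁻¹.mulVec v.ofLp) ⬝ᵥ (A i).mulVec ((L i).mulVec (P⁻¹.mulVec v.ofLp))) := by
        intro i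
        rw [← real_inner_self_eq_norm_sq, BL.inner_eq, BL.clm_ofLp, ← BL.quad (Q i) (A i) _ (hQ i)]
        simp only [hW, ← mulVec_mulVec]
      have e2 : ‖v‖ ^ 2 = 2 * Real.pi * (P⁻¹.mulVec v.ofLp ⬝ᵥ M.mulVec (P⁻¹.mulVec v.ofLp)) := by
        rw [← BL.quad P M _ hP, hPP', ← BL.inner_eq, real_inner_self_eq_norm_sq]
      rw [e2, hMeq, BL.quad_M, mul_add, Finset.mul_sum]
      have e3 : 0 ≤ 2 * Real.pi * (δ * (P⁻¹.mulVec v.ofLp ⬝ᵥ P⁻¹.mulVec v.ofLp)) := by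
        have : 0 ≤ P⁻¹.mulVec v.ofLp ⬝ᵥ P⁻¹.mulVec v.ofLp := by
          unfold dotProduct
          exact Finset.sum_nonneg fun i _ => mul_self_nonneg _
        positivity
      refine le_trans (le_of_eq ?_) (le_add_of_nonneg_left e3)
      refine Finset.sum_congr rfl fun i _ => ?_
      rw [e1]; ring)
    h hhm (fun i => by
      rw [hhintEq]
      exact ENNReal.mul_ne_top ofReal_ne_top (hfin i))
  have hH : Measurable (fun x : Fin n → ℝ => ∏ i, (f i ((Q i)⁻¹.mulVec ((W i).mulVec x)) *
      ENNReal.ofReal (Real.exp (Real.pi * ((Q i)⁻¹.mulVec ((W i).mulVec x) ⬝ᵥ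
        (A i).mulVec ((Q i)⁻¹.mulVec ((W i).mulVec x)))))) ^ q i) := by
    refine Finset.measurable_prod _ fun i _ => Measurable.pow_const ?_ _
    exact (hhm' i).comp (f := fun x => (W i).mulVec x) (Continuous.measurable (by fun_prop))
  have hL := BL.gauss_cov P M hM hP _ hH
  simp only [hh, BL.clm_ofLp] at hG
  rw [hL] at hG
  have hW' : ∀ i y, (Q i)⁻¹.mulVec ((W i).mulVec (P.mulVec y)) = (L i).mulVec y := by
    intro i y
    simp only [hW, ← mulVec_mulVec]
    rw [hPP, hQQ]
  have hI : (∫⁻ y : Fin n → ℝ, (∏ i, (f i ((Q i)⁻¹.mulVec ((W i).mulVec (P.mulVec y))) *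
      ENNReal.ofReal (Real.exp (Real.pi * ((Q i)⁻¹.mulVec ((W i).mulVec (P.mulVec y)) ⬝ᵥ
        (A i).mulVec ((Q i)⁻¹.mulVec ((W i).mulVec (P.mulVec y))))))) ^ q i) *
        ENNReal.ofReal (Real.exp (-Real.pi * (y ⬝ᵥ M.mulVec y)))) =
      ∫⁻ x : Fin n → ℝ, (∏ i, (f i ((L i).mulVec x)) ^ q i) *
        ENNReal.ofReal (Real.exp (-Real.pi * (δ * (x ⬝ᵥ x)))) := by
    refine lintegral_congr fun y => ?_
    simp only [hW']
    simp only [ENNReal.mul_rpow_of_nonneg _ _ (hq _)]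
    rw [Finset.prod_mul_distrib, mul_assoc]
    congr 1
    have : ∀ i, ENNReal.ofReal (Real.exp (Real.pi * ((L i).mulVec y ⬝ᵥ
        (A i).mulVec ((L i).mulVec y)))) ^ q i = ENNReal.ofReal (Real.exp (Real.pi * (q i * ((L i).mulVec y ⬝ᵥ
        (A i).mulVec ((L i).mulVec y))))) := by
      intro i
      rw [ENNReal.ofReal_rpow_of_nonneg (Real.exp_nonneg _) (hq i), ← Real.exp_mul]
      congr 2; ring
    simp only [this]
    rw [← ENNReal.ofReal_prod_of_nonneg fun i _ => Real.exp_nonneg _, ← Real.exp_sum,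
      ← ENNReal.ofReal_mul (Real.exp_nonneg _), ← Real.exp_add, hMeq, BL.quad_M, ← Finset.mul_sum]
    congr 2; ring
  rw [hI] at hG
  refine hG.trans (le_of_eq ?_)
  have : ∀ i, ∫⁻ z : EuclideanSpace ℝ (Fin (ni i)), f i ((Q i)⁻¹.mulVec z.ofLp) * ENNReal.ofReal (Real.exp (Real.pi *
      ((Q i)⁻¹.mulVec z.ofLp ⬝ᵥ (A i).mulVec ((Q i)⁻¹.mulVec z.ofLp))))
      ∂(stdGaussian (EuclideanSpace ℝ (Fin (ni i)))) = ENNReal.ofReal √(A i).det * ∫⁻ y, f i y := hhintEq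
  simp only [this, ENNReal.mul_rpow_of_nonneg _ _ (hq _)]
  rw [Finset.prod_mul_distrib]
  congr 1
  have hd : ∀ i, 0 ≤ (A i).det := fun i => (hA i).det_pos.le
  have e : √(∏ i, (A i).det ^ q i) = ∏ i, √(A i).det ^ q i := by
    rw [Real.sqrt_eq_rpow, ← Real.finsetProd_rpow _ _ fun i _ => Real.rpow_nonneg (hd i) _]
    refine Finset.prod_congr rfl fun i _ => ?_
    rw [Real.sqrt_eq_rpow, ← Real.rpow_mul (hd i), ← Real.rpow_mul (hd i), mul_comm]
  rw [e, ENNReal.ofReal_prod_of_nonneg fun i _ => Real.rpow_nonneg (Real.sqrt_nonneg _) _]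
  refine Finset.prod_congr rfl fun i _ => ?_
  rw [ENNReal.ofReal_rpow_of_nonneg (Real.sqrt_nonneg _) (hq i)]

end weighted

section extrem

lemma BL.diagz {n : ℕ} (X : Matrix (Fin n) (Fin n) ℝ) (hX : X.IsHermitian) :
    ∃ (U : Matrix (Fin n) (Fin n) ℝ) (x : Fin n → ℝ), Uᵀ * U = 1 ∧ U * Uᵀ = 1 ∧
      X = U * diagonal x * Uᵀ := by
  have h := hX.spectral_theorem
  have h1 := (Matrix.mem_unitaryGroup_iff).1 hX.eigenvectorUnitary.2
  have h2 := (Matrix.mem_unitaryGroup_iff').1 hX.eigenvectorUnitary.2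
  rw [star_eq_conjTranspose, conjTranspose_eq_transpose_of_trivial] at h1 h2
  refine ⟨hX.eigenvectorUnitary, hX.eigenvalues, h2, h1, ?_⟩
  rw [Unitary.conjStarAlgAut_apply] at h
  rw [star_eq_conjTranspose, conjTranspose_eq_transpose_of_trivial] at h
  exact h

lemma BL.diag_eq {n : ℕ} {X U : Matrix (Fin n) (Fin n) ℝ} {x : Fin n → ℝ} (h1 : Uᵀ * U = 1)
    (h : X = U * diagonal x * Uᵀ) : Uᵀ * X * U = diagonal x := by
  rw [h]
  calc Uᵀ * (U * diagonal x * Uᵀ) * U = (Uᵀ * U) * diagonal x * (Uᵀ * U) := by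
        simp only [Matrix.mul_assoc]
    _ = _ := by rw [h1]; simp

lemma BL.diag_det {n : ℕ} {X U : Matrix (Fin n) (Fin n) ℝ} {x : Fin n → ℝ} (h2 : U * Uᵀ = 1)
    (h : X = U * diagonal x * Uᵀ) (a b : ℝ) :
    (a • (1 : Matrix (Fin n) (Fin n) ℝ) + b • X).det = ∏ j, (a + b * x j) := by
  have e : a • (1 : Matrix (Fin n) (Fin n) ℝ) + b • X
      = U * diagonal (fun j => a + b * x j) * Uᵀ := by
    have : diagonal (fun j => a + b * x j) = a • (1 : Matrix (Fin n) (Fin n) ℝ) + b • diagonal x := by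
      ext i j
      by_cases hij : i = j
      · subst hij; simp
      · simp [hij]
    rw [this, Matrix.mul_add, Matrix.add_mul]
    simp [h2, h]
  have hd : U.det * Uᵀ.det = 1 := by rw [← det_mul, h2, det_one]
  rw [e, det_mul, det_mul, det_diagonal]
  linear_combination (∏ j, (a + b * x j)) * hd

lemma BL.diag_trace {n : ℕ} {X U : Matrix (Fin n) (Fin n) ℝ} {x : Fin n → ℝ} (h1 : Uᵀ * U = 1)
    (h : X = U * diagonal x * Uᵀ) : X.trace = ∑ j, x j := by
  rw [h, trace_mul_comm, ← Matrix.mul_assoc, h1, Matrix.one_mul, trace_diagonal]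

lemma BL.diag_nn {n : ℕ} {X U : Matrix (Fin n) (Fin n) ℝ} {x : Fin n → ℝ} (h1 : Uᵀ * U = 1)
    (h : X = U * diagonal x * Uᵀ) (hX : X.PosSemidef) (j) : 0 ≤ x j := by
  have := BL.diag_eq h1 h
  have h3 := hX.conjTranspose_mul_mul_same U
  rw [conjTranspose_eq_transpose_of_trivial, this] at h3
  have := h3.diag_nonneg (i := j)
  simpa using this

lemma BL.entry_bd {n : ℕ} {Y : Matrix (Fin n) (Fin n) ℝ} (hY : Y.PosSemidef) (a b : Fin n) :
    |Y a b| ≤ Y.trace := by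
  have h := (hY.submatrix ![a, b]).det_nonneg
  rw [det_fin_two] at h
  simp at h
  have hs : Y b a = Y a b := by
    have := hY.1.apply a b
    simpa using this
  rw [hs] at h
  have ht : ∀ c, Y c c ≤ Y.trace := fun c =>
    Finset.single_le_sum (f := fun c => Y c c) (fun i _ => hY.diag_nonneg) (Finset.mem_univ c)
  have ha := hY.diag_nonneg (i := a)
  have hb := hY.diag_nonneg (i := b)
  apply abs_le_of_sq_le_sq _ (ha.trans (ht a))
  nlinarith [ht a, ht b, mul_le_mul (ht a) (ht b) hb (ha.trans (ht a))]

lemma BL.det_amgm {n : ℕ} (X : Matrix (Fin n) (Fin n) ℝ) (hX : X.PosSemidef) (δ : ℝ) (h0 : 0 < δ) (h1 : δ < 1) :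
    X.det ^ (1 - δ) ≤ (δ • (1 : Matrix (Fin n) (Fin n) ℝ) + (1 - δ) • X).det := by
  obtain ⟨U, x, hU1, hU2, h⟩ := BL.diagz X hX.1
  have hx := BL.diag_nn hU1 h hX
  have e1 := BL.diag_det hU2 h 0 1
  simp at e1
  rw [BL.diag_det hU2 h, e1, ← Real.finsetProd_rpow _ _ (fun i _ => hx i)]
  apply Finset.prod_le_prod
  · intro i _; exact Real.rpow_nonneg (hx i) _
  · intro i _
    have := Real.geom_mean_le_arith_mean2_weighted h0.le (sub_nonneg.2 h1.le) zero_le_one (hx i) (by ring)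
    simpa using this

/-- control of trace -/
lemma BL.trace_bd {n : ℕ} (X : Matrix (Fin n) (Fin n) ℝ) (hX : X.PosSemidef) (δ : ℝ) (h0 : 0 < δ) (h1 : δ < 1)
    (E : ℝ) (hE : 0 ≤ E) (hle : (δ • (1 : Matrix (Fin n) (Fin n) ℝ) + (1 - δ) • X).det ≤ E * X.det ^ (1 - δ)) :
    X.trace ≤ n * (E / (1 - δ)) ^ (1 / δ) := by
  obtain ⟨U, x, hU1, hU2, h⟩ := BL.diagz X hX.1
  have hx := BL.diag_nn hU1 h hX
  have e1 := BL.diag_det hU2 h 0 1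
  simp at e1
  rw [BL.diag_det hU2 h, e1, ← Real.finsetProd_rpow _ _ (fun i _ => hx i)] at hle
  rw [BL.diag_trace hU1 h]
  have hd : 0 < 1 - δ := by linarith
  have key : ∀ k, x k ≤ (E / (1 - δ)) ^ (1 / δ) := by
    intro k
    rcases (hx k).eq_or_lt with hk | hk
    · rw [← hk]; positivity
    have hpos : ∀ i, 0 < δ + (1 - δ) * x i := fun i => by have := hx i; positivity
    rw [← Finset.mul_prod_erase _ _ (Finset.mem_univ k), ← Finset.mul_prod_erase _ _ (Finset.mem_univ k)] at hle
    have hle2 : ∏ i ∈ Finset.univ.erase k, x i ^ (1 - δ) ≤ ∏ i ∈ Finset.univ.erase k, (δ + (1 - δ) * x i) := by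
      apply Finset.prod_le_prod
      · intro i _; exact Real.rpow_nonneg (hx i) _
      · intro i _
        have := Real.geom_mean_le_arith_mean2_weighted h0.le (sub_nonneg.2 h1.le) zero_le_one (hx i) (by ring)
        simpa using this
    have hP : 0 < ∏ i ∈ Finset.univ.erase k, (δ + (1 - δ) * x i) := Finset.prod_pos fun i _ => hpos i
    have h3 : (δ + (1 - δ) * x k) ≤ E * x k ^ (1 - δ) := by
      refine le_of_mul_le_mul_right (hle.trans ?_) hP
      rw [← mul_assoc]
      gcongr
    have h4 : (1 - δ) * x k ≤ E * x k ^ (1 - δ) := by linarith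
    have h5 : x k = x k ^ δ * x k ^ (1 - δ) := by
      rw [← Real.rpow_add hk]; simp
    have h6 : x k ^ δ ≤ E / (1 - δ) := by
      rw [le_div_iff₀ hd]
      have hk2 : 0 < x k ^ (1 - δ) := Real.rpow_pos_of_pos hk _
      refine le_of_mul_le_mul_right ?_ hk2
      nlinarith
    calc x k = (x k ^ δ) ^ (1 / δ) := by rw [← Real.rpow_mul hk.le]; field_simp; simp
      _ ≤ _ := Real.rpow_le_rpow (Real.rpow_nonneg hk.le _) h6 (by positivity)
  calc ∑ j, x j ≤ ∑ j : Fin n, (E / (1 - δ)) ^ (1 / δ) := Finset.sum_le_sum fun i _ => key i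
    _ = _ := by simp

end extrem

section crit
open Topology Filter

lemma BL.pd_perturb {n : ℕ} (A H : Matrix (Fin n) (Fin n) ℝ) (hA : A.PosDef) (hH : Hᵀ = H) :
    ∀ᶠ t in 𝓝 (0:ℝ), (A + t • H).PosDef := by
  obtain ⟨P, hP, hPu⟩ := BL.exists_sqrt A hA
  have hPi : P⁻¹ * P = 1 := Matrix.nonsing_inv_mul _ hPu
  have hPi' : Pᵀ * (P⁻¹)ᵀ = 1 := by rw [← transpose_mul, hPi, transpose_one]
  obtain ⟨U, j, hU1, hU2, hj⟩ := BL.diagz ((P⁻¹)ᵀ * H * P⁻¹) (by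
    rw [IsHermitian, conjTranspose_eq_transpose_of_trivial]
    simp [transpose_mul, hH, Matrix.mul_assoc])
  have hpi := Real.pi_pos
  have hev : ∀ᶠ t in 𝓝 (0:ℝ), ∀ k, 0 < (2 * Real.pi)⁻¹ + t * j k := by
    rw [eventually_all]
    intro k
    have : ContinuousAt (fun t : ℝ => (2 * Real.pi)⁻¹ + t * j k) 0 := by fun_prop
    apply this.eventually (lt_mem_nhds _)
    simp; positivity
  filter_upwards [hev] with t ht
  have hA2 : A = (2 * Real.pi)⁻¹ • (Pᵀ * P) := by
    rw [hP, smul_smul, inv_mul_cancel₀ (by positivity), one_smul]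
  have hH2 : H = Pᵀ * ((P⁻¹)ᵀ * H * P⁻¹) * P := by
    calc H = (Pᵀ * (P⁻¹)ᵀ) * H * (P⁻¹ * P) := by rw [hPi', hPi]; simp
      _ = _ := by simp only [Matrix.mul_assoc]
  have e : A + t • H = (Uᵀ * P)ᴴ * diagonal (fun k => (2 * Real.pi)⁻¹ + t * j k) * (Uᵀ * P) := by
    have : diagonal (fun k => (2 * Real.pi)⁻¹ + t * j k)
        = (2 * Real.pi)⁻¹ • (1 : Matrix (Fin n) (Fin n) ℝ) + t • diagonal j := by
      ext a b
      by_cases hij : a = b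
      · subst hij; simp
      · simp [hij]
    rw [this, conjTranspose_eq_transpose_of_trivial, transpose_mul, transpose_transpose]
    rw [hH2, hj, hA2, Matrix.mul_add, Matrix.add_mul]
    have : Pᵀ * U * (Uᵀ * P) = Pᵀ * P := by
      calc _ = Pᵀ * (U * Uᵀ) * P := by simp only [Matrix.mul_assoc]
        _ = _ := by rw [hU2]; simp
    simp only [Matrix.mul_smul, Matrix.smul_mul, Matrix.mul_one, this]
    simp only [Matrix.mul_assoc]
  rw [e]
  apply PosDef.conjTranspose_mul_mul_same
  · exact PosDef.diagonal ht
  · apply Matrix.mulVec_injective_of_isUnit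
    rw [Matrix.isUnit_iff_isUnit_det, det_mul]
    refine IsUnit.mul ?_ hPu
    exact isUnit_iff_exists_inv.2 ⟨U.det, by rw [← det_mul, hU1, det_one]⟩

lemma BL.det_deriv {n : ℕ} (X : Matrix (Fin n) (Fin n) ℝ) :
    HasDerivAt (fun t : ℝ => (1 + t • X).det) X.trace 0 := by
  rw [show (fun t : ℝ => (1 + t • X).det) = _ from funext fun t => det_one_add_smul t X]
  generalize (det (1 + (Polynomial.X : Polynomial ℝ) • X.map Polynomial.C)).divX.divX = Q
  have h1 : HasDerivAt (fun t : ℝ => 1 + X.trace * t) X.trace 0 := by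
    simpa using ((hasDerivAt_id (0:ℝ)).const_mul X.trace).const_add 1
  have h2 := (Q.hasDerivAt 0).mul ((hasDerivAt_id (0:ℝ)).pow 2)
  have h3 := h1.add h2
  simp at h3
  exact h3

lemma BL.crit {ι : Type*} [Fintype ι] [DecidableEq ι] {n : ℕ} {ni : ι → ℕ}
    (L : ∀ i, Matrix (Fin (ni i)) (Fin n) ℝ) (q : ι → ℝ) (hq : ∀ i, 0 < q i) (δ : ℝ)
    (A : ∀ i, Matrix (Fin (ni i)) (Fin (ni i)) ℝ) (hA : ∀ i, (A i).PosDef)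
    (hM : (δ • (1 : Matrix (Fin n) (Fin n) ℝ) + ∑ i, q i • ((L i)ᵀ * A i * L i)).PosDef)
    (hmax : ∀ B : ∀ i, Matrix (Fin (ni i)) (Fin (ni i)) ℝ, (∀ i, (B i).PosDef) →
      (∏ i, (B i).det ^ q i) * (δ • (1 : Matrix (Fin n) (Fin n) ℝ) + ∑ i, q i • ((L i)ᵀ * A i * L i)).det
      ≤ (∏ i, (A i).det ^ q i) * (δ • (1 : Matrix (Fin n) (Fin n) ℝ) + ∑ i, q i • ((L i)ᵀ * B i * L i)).det)
    (i : ι) : L i * (δ • (1 : Matrix (Fin n) (Fin n) ℝ) + ∑ i, q i • ((L i)ᵀ * A i * L i))⁻¹ * (L i)ᵀ = (A i)⁻¹ := by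
  set M := δ • (1 : Matrix (Fin n) (Fin n) ℝ) + ∑ i, q i • ((L i)ᵀ * A i * L i) with hMdef
  have hAt : ∀ i, (A i)ᵀ = A i := fun i => by
    rw [← conjTranspose_eq_transpose_of_trivial]; exact (hA i).1
  have hMt : Mᵀ = M := by rw [← conjTranspose_eq_transpose_of_trivial]; exact hM.1
  have hMu : IsUnit M.det := hM.det_pos.ne'.isUnit
  have hAu : IsUnit (A i).det := (hA i).det_pos.ne'.isUnit
  set H := (A i)⁻¹ - L i * M⁻¹ * (L i)ᵀ with hHdef
  have hH : Hᵀ = H := by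
    rw [hHdef, transpose_sub, transpose_nonsing_inv, hAt]
    simp [transpose_mul, transpose_nonsing_inv, hMt, Matrix.mul_assoc]
  set N := q i • ((L i)ᵀ * H * L i) with hN
  have hev : ∀ᶠ t in 𝓝 (0:ℝ), (1 + t • ((A i)⁻¹ * H)).det ^ q i ≤ (1 + t • (M⁻¹ * N)).det := by
    filter_upwards [BL.pd_perturb (A i) H (hA i) hH] with t ht
    have hB : ∀ j, (Function.update A i (A i + t • H) j).PosDef := by
      intro j
      by_cases hj : j = i
      · subst hj; simpa using ht
      · simpa [hj] using hA j
    have h1 := hmax _ hB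
    have e1 : δ • (1 : Matrix (Fin n) (Fin n) ℝ) + ∑ j, q j • ((L j)ᵀ * Function.update A i (A i + t • H) j * L j)
        = M + t • N := by
      rw [hMdef, ← Finset.add_sum_erase _ _ (Finset.mem_univ i), ← Finset.add_sum_erase _ _ (Finset.mem_univ i)]
      rw [Finset.sum_congr rfl (g := fun j => q j • ((L j)ᵀ * A j * L j)) (fun j hj => by
        rw [Function.update_of_ne (Finset.ne_of_mem_erase hj)])]
      rw [Function.update_self, Matrix.mul_add, Matrix.add_mul, smul_add, hN]
      simp only [Matrix.mul_smul, Matrix.smul_mul]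
      rw [smul_comm (q i) t]
      abel
    have e2 : ∏ j, (Function.update A i (A i + t • H) j).det ^ q j =
       (A i + t • H).det ^ q i * ∏ j ∈ Finset.univ.erase i, (A j).det ^ q j := by
      rw [← Finset.mul_prod_erase _ _ (Finset.mem_univ i), Function.update_self]
      rw [Finset.prod_congr rfl (fun j hj => by
        rw [Function.update_of_ne (Finset.ne_of_mem_erase hj)])]
    have hA' : A i + t • H = A i * (1 + t • ((A i)⁻¹ * H)) := by
      rw [Matrix.mul_add, Matrix.mul_smul, ← Matrix.mul_assoc, Matrix.mul_nonsing_inv _ hAu]; simp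
    have hM' : M + t • N = M * (1 + t • (M⁻¹ * N)) := by
      rw [Matrix.mul_add, Matrix.mul_smul, ← Matrix.mul_assoc, Matrix.mul_nonsing_inv _ hMu]; simp
    rw [e1, e2, ← Finset.mul_prod_erase _ _ (Finset.mem_univ i), hM', det_mul] at h1
    have hdp : 0 < (1 + t • ((A i)⁻¹ * H)).det := by
      have := ht.det_pos
      rw [hA', det_mul] at this
      exact (mul_pos_iff_of_pos_left (hA i).det_pos).1 this
    rw [hA', det_mul, Real.mul_rpow (hA i).det_pos.le hdp.le] at h1
    have hc : 0 < (A i).det ^ q i * (∏ j ∈ Finset.univ.erase i, (A j).det ^ q j) * M.det := by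
      have := (hA i).det_pos
      have := hM.det_pos
      have : 0 < ∏ j ∈ Finset.univ.erase i, (A j).det ^ q j := 
        Finset.prod_pos fun j _ => Real.rpow_pos_of_pos (hA j).det_pos _
      positivity
    refine le_of_mul_le_mul_left ?_ hc
    linarith
  have hd1 := BL.det_deriv (M⁻¹ * N)
  have hd2 := (BL.det_deriv ((A i)⁻¹ * H)).rpow_const (p := q i) (by left; simp)
  have hd := hd1.sub hd2
  have hmin : IsLocalMin ((fun t : ℝ => (1 + t • (M⁻¹ * N)).det) - fun t : ℝ => (1 + t • ((A i)⁻¹ * H)).det ^ q i) 0 := by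
    filter_upwards [hev] with t ht
    simp
    exact ht
  have hz := hmin.hasDerivAt_eq_zero hd
  simp [hN] at hz
  have e3 : (M⁻¹ * ((L i)ᵀ * H * L i)).trace = (L i * M⁻¹ * (L i)ᵀ * H).trace := by
    rw [← Matrix.mul_assoc, trace_mul_comm]; simp only [Matrix.mul_assoc]
  rw [e3] at hz
  have hz2 : (Hᴴ * H).trace = 0 := by
    rw [conjTranspose_eq_transpose_of_trivial, hH]
    nth_rw 1 [hHdef]
    rw [Matrix.sub_mul, trace_sub]
    have := hq i
    have h4 : q i * (((A i)⁻¹ * H).trace - (L i * M⁻¹ * (L i)ᵀ * H).trace) = 0 := by linarith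
    exact (mul_eq_zero.1 h4).resolve_left this.ne'
  rw [Matrix.trace_conjTranspose_mul_self_eq_zero_iff, hHdef, sub_eq_zero] at hz2
  exact hz2.symm

end crit

section exist
open Topology Filter

lemma BL.psd_closed {n : ℕ} : IsClosed {A : Matrix (Fin n) (Fin n) ℝ | A.PosSemidef} := by
  have : {A : Matrix (Fin n) (Fin n) ℝ | A.PosSemidef} =
      {A | Aᵀ = A} ∩ ⋂ x : Fin n → ℝ, {A | 0 ≤ x ⬝ᵥ A.mulVec x} := by
    ext A
    simp only [Set.mem_setOf_eq, Set.mem_inter_iff, Set.mem_iInter]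
    rw [posSemidef_iff_dotProduct_mulVec, IsHermitian, conjTranspose_eq_transpose_of_trivial]
    simp
  rw [this]
  refine IsClosed.inter (isClosed_eq (by fun_prop) (by fun_prop)) (isClosed_iInter fun x => isClosed_le (by fun_prop) ?_)
  unfold mulVec dotProduct
  fun_prop

lemma BL.psd_L {a n : ℕ} (L : Matrix (Fin a) (Fin n) ℝ) {A : Matrix (Fin a) (Fin a) ℝ} (hA : A.PosSemidef) :
    (Lᵀ * A * L).PosSemidef := by
  have := hA.conjTranspose_mul_mul_same L
  rwa [conjTranspose_eq_transpose_of_trivial] at this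

lemma BL.right_inv {a n : ℕ} (L : Matrix (Fin a) (Fin n) ℝ) (hL : Function.Surjective L.mulVec) :
    ∃ S : Matrix (Fin n) (Fin a) ℝ, L * S = 1 := Matrix.mulVec_surjective_iff_exists_right_inverse.1 hL

lemma BL.extremizer {ι : Type*} [Fintype ι] [DecidableEq ι] {n : ℕ} {ni : ι → ℕ}
    (L : ∀ i, Matrix (Fin (ni i)) (Fin n) ℝ) (hL : ∀ i, Function.Surjective ((L i).mulVec))
    (p : ι → ℝ) (hp : ∀ i, 0 < p i) (δ : ℝ) (h0 : 0 < δ) (h1 : δ < 1) (D : ℝ) (hD0 : 0 ≤ D)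
    (hD : ∀ A : ∀ i, Matrix (Fin (ni i)) (Fin (ni i)) ℝ, (∀ i, (A i).PosDef) →
      ∏ i, (A i).det ^ p i ≤ D * (∑ i, p i • ((L i)ᵀ * A i * L i)).det) :
    ∃ A : ∀ i, Matrix (Fin (ni i)) (Fin (ni i)) ℝ, (∀ i, (A i).PosDef) ∧
      (δ • (1 : Matrix (Fin n) (Fin n) ℝ) + ∑ i, ((1 - δ) * p i) • ((L i)ᵀ * A i * L i)).PosDef ∧
      (∀ i, L i * (δ • (1 : Matrix (Fin n) (Fin n) ℝ) + ∑ i, ((1 - δ) * p i) • ((L i)ᵀ * A i * L i))⁻¹ * (L i)ᵀ = (A i)⁻¹) ∧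
      ∏ i, (A i).det ^ ((1 - δ) * p i) ≤ D ^ (1 - δ) *
        (δ • (1 : Matrix (Fin n) (Fin n) ℝ) + ∑ i, ((1 - δ) * p i) • ((L i)ᵀ * A i * L i)).det := by
  have hd : 0 < 1 - δ := by linarith
  set X : (∀ i, Matrix (Fin (ni i)) (Fin (ni i)) ℝ) → Matrix (Fin n) (Fin n) ℝ :=
    fun A => ∑ i, p i • ((L i)ᵀ * A i * L i) with hX
  set MM : (∀ i, Matrix (Fin (ni i)) (Fin (ni i)) ℝ) → Matrix (Fin n) (Fin n) ℝ :=
    fun A => δ • (1 : Matrix (Fin n) (Fin n) ℝ) + ∑ i, ((1 - δ) * p i) • ((L i)ᵀ * A i * L i) with hMM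
  have hMX : ∀ A, MM A = δ • (1 : Matrix (Fin n) (Fin n) ℝ) + (1 - δ) • X A := by
    intro A; simp only [hMM, hX, Finset.smul_sum, smul_smul]
  have hXp : ∀ A, (∀ i, (A i).PosSemidef) → (X A).PosSemidef := fun A hA =>
    posSemidef_sum _ fun i _ => (BL.psd_L (L i) (hA i)).smul (hp i).le
  have hMp : ∀ A, (∀ i, (A i).PosSemidef) → (MM A).PosDef := fun A hA => by
    rw [hMX]
    exact (PosDef.one.smul h0).add_posSemidef ((hXp A hA).smul hd.le)
  have hq1 : ∀ A, (∀ i, (A i).PosDef) → ∏ i, (A i).det ^ ((1 - δ) * p i) ≤ D ^ (1 - δ) * (X A).det ^ (1 - δ) := by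
    intro A hA
    have e : ∏ i, (A i).det ^ ((1 - δ) * p i) = (∏ i, (A i).det ^ (p i)) ^ (1 - δ) := by
      rw [← Real.finsetProd_rpow _ _ (fun i _ => Real.rpow_nonneg (hA i).det_pos.le _)]
      refine Finset.prod_congr rfl fun i _ => ?_
      rw [← Real.rpow_mul (hA i).det_pos.le, mul_comm]
    rw [e, ← Real.mul_rpow hD0 (hXp A fun i => (hA i).posSemidef).det_nonneg]
    exact Real.rpow_le_rpow (Finset.prod_nonneg fun i _ => Real.rpow_nonneg (hA i).det_pos.le _) (hD A hA) hd.le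
  have hq2 : ∀ A, (∀ i, (A i).PosDef) → ∏ i, (A i).det ^ ((1 - δ) * p i) ≤ D ^ (1 - δ) * (MM A).det := by
    intro A hA
    refine (hq1 A hA).trans ?_
    rw [hMX]
    gcongr
    exact BL.det_amgm _ (hXp A fun i => (hA i).posSemidef) δ h0 h1
  set Ψ : (∀ i, Matrix (Fin (ni i)) (Fin (ni i)) ℝ) → ℝ :=
    fun A => (∏ i, (A i).det ^ ((1 - δ) * p i)) / (MM A).det with hΨ
  have hone : ∀ i, ((1 : ∀ i, Matrix (Fin (ni i)) (Fin (ni i)) ℝ) i).PosDef := fun i => PosDef.one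
  set c0 := Ψ 1 with hc0
  have hc0p : 0 < c0 := by
    rw [hc0]
    exact div_pos (Finset.prod_pos fun i _ => Real.rpow_pos_of_pos (hone i).det_pos _) (hMp 1 fun i => (hone i).posSemidef).det_pos
  set T := n * (c0⁻¹ * D ^ (1 - δ) / (1 - δ)) ^ (1 / δ) with hT
  have htr : ∀ A, (∀ i, (A i).PosDef) → c0 ≤ Ψ A → (X A).trace ≤ T := by
    intro A hA hc
    refine BL.trace_bd _ (hXp A fun i => (hA i).posSemidef) δ h0 h1 _ (by positivity) ?_
    rw [← hMX, mul_assoc, inv_mul_eq_div, le_div_iff₀ hc0p]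
    have := (le_div_iff₀ (hMp A fun i => (hA i).posSemidef).det_pos).1 hc
    linarith [hq1 A hA]
  choose S hS using fun i => BL.right_inv (L i) (hL i)
  set C : ∀ i, Fin (ni i) → Fin (ni i) → ℝ := fun i a b => ∑ d, (∑ c, |S i c a| * (T / p i)) * |S i d b| with hC
  have hbd : ∀ A, (∀ i, (A i).PosDef) → c0 ≤ Ψ A → ∀ i a b, |A i a b| ≤ C i a b := by
    intro A hA hc i a b
    set Y := (L i)ᵀ * A i * L i with hY
    have hYp : Y.PosSemidef := BL.psd_L (L i) (hA i).posSemidef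
    have hYt : Y.trace ≤ T / p i := by
      rw [le_div_iff₀ (hp i)]
      refine le_trans ?_ (htr A hA hc)
      simp only [hX]
      rw [trace_sum]
      have := Finset.single_le_sum (f := fun i => (p i • ((L i)ᵀ * A i * L i)).trace) (s := Finset.univ)
        (fun j _ => by
          simp only [trace_smul]
          exact smul_nonneg (hp j).le (BL.psd_L (L j) (hA j).posSemidef).trace_nonneg) (Finset.mem_univ i)
      simp only [trace_smul, smul_eq_mul] at this ⊢
      rw [mul_comm]; exact this
    have hAY : A i = (S i)ᵀ * Y * S i := by
      have hs' : (S i)ᵀ * (L i)ᵀ = 1 := by rw [← transpose_mul, hS, transpose_one]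
      calc A i = ((S i)ᵀ * (L i)ᵀ) * A i * (L i * S i) := by rw [hs', hS]; simp
        _ = _ := by rw [hY]; simp only [Matrix.mul_assoc]
    rw [hAY]
    simp only [mul_apply, transpose_apply, hC]
    refine (Finset.abs_sum_le_sum_abs _ _).trans (Finset.sum_le_sum fun d _ => ?_)
    rw [abs_mul]
    refine mul_le_mul_of_nonneg_right ?_ (abs_nonneg _)
    refine (Finset.abs_sum_le_sum_abs _ _).trans (Finset.sum_le_sum fun c _ => ?_)
    rw [abs_mul]
    exact mul_le_mul_of_nonneg_left ((BL.entry_bd hYp c d).trans hYt) (abs_nonneg _)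
  set K : Set (∀ i, Matrix (Fin (ni i)) (Fin (ni i)) ℝ) :=
    Set.univ.pi fun i => {B | B.PosSemidef} ∩ (Set.univ.pi fun a => Set.univ.pi fun b => Set.Icc (-C i a b) (C i a b)) with hK
  have hKc : IsCompact K := by
    refine isCompact_univ_pi fun i => ?_
    refine IsCompact.inter_left ?_ BL.psd_closed
    exact isCompact_univ_pi fun a => isCompact_univ_pi fun b => isCompact_Icc
  have hmem : ∀ A, (∀ i, (A i).PosDef) → c0 ≤ Ψ A → A ∈ K := by
    intro A hA hc i _
    exact ⟨(hA i).posSemidef, fun a _ b _ => abs_le.1 (hbd A hA hc i a b)⟩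
  have hcont : ContinuousOn Ψ K := by
    refine ContinuousOn.div ?_ ?_ ?_
    · refine continuousOn_finsetProd _ fun i _ => ?_
      refine ContinuousOn.rpow_const ?_ fun A _ => Or.inr (mul_pos hd (hp i)).le
      exact Continuous.continuousOn ((continuous_apply i).matrix_det)
    · refine Continuous.continuousOn (Continuous.matrix_det ?_)
      simp only [hMM]
      fun_prop
    · intro A hA
      exact (hMp A fun i => (hA i trivial).1).det_pos.ne'
  obtain ⟨A, hAK, hAmax⟩ := hKc.exists_isMaxOn ⟨1, hmem 1 hone le_rfl⟩ hcont
  have hAc : c0 ≤ Ψ A := hAmax (hmem 1 hone le_rfl)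
  have hAps : ∀ i, (A i).PosSemidef := fun i => (hAK i trivial).1
  have hMA := hMp A hAps
  have hApd : ∀ i, (A i).PosDef := by
    intro i
    rw [(hAps i).posDef_iff_isUnit, Matrix.isUnit_iff_isUnit_det, isUnit_iff_ne_zero]
    intro hz
    have : Ψ A = 0 := by
      simp only [hΨ]
      rw [Finset.prod_eq_zero (Finset.mem_univ i), zero_div]
      rw [hz, Real.zero_rpow (mul_pos hd (hp i)).ne']
    linarith
  refine ⟨A, hApd, hMA, ?_, hq2 A hApd⟩
  refine BL.crit L _ (fun i => mul_pos hd (hp i)) δ A hApd hMA ?_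
  intro B hB
  have hle : Ψ B ≤ Ψ A := by
    rcases le_total c0 (Ψ B) with h | h
    · exact hAmax (hmem B hB h)
    · exact h.trans hAc
  have hMB := hMp B fun i => (hB i).posSemidef
  rwa [hΨ, div_le_div_iff₀ hMB.det_pos hMA.det_pos] at hle

end exist

section upper
open Topology Filter

lemma BL.rpow_lim (a : ℝ≥0∞) (u : ℕ → ℝ) (hu : ∀ k, 0 < u k) (hl : Tendsto u atTop (𝓝 1)) :
    Tendsto (fun k => a ^ u k) atTop (𝓝 a) := by
  by_cases h0 : a = 0
  · subst h0
    simp [ENNReal.zero_rpow_of_pos, hu]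
  by_cases ht : a = ⊤
  · subst ht
    simp [ENNReal.top_rpow_of_pos, hu]
  lift a to NNReal using ht
  have h0' : a ≠ 0 := by simpa using h0
  have h : Tendsto (fun k => a ^ u k) atTop (𝓝 (a ^ (1:ℝ))) :=
    ((NNReal.continuousAt_rpow (x := a) (y := 1) (Or.inl h0')).tendsto).comp (tendsto_const_nhds.prodMk_nhds hl)
  rw [NNReal.rpow_one] at h
  have h2 := (ENNReal.tendsto_coe.2 h)
  refine h2.congr fun k => ?_
  rw [ENNReal.coe_rpow_of_ne_zero h0']

lemma BL.upper_pos {ι : Type*} [Fintype ι] {n : ℕ} {ni : ι → ℕ}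
    (L : ∀ i, Matrix (Fin (ni i)) (Fin n) ℝ) (hL : ∀ i, Function.Surjective ((L i).mulVec))
    (p : ι → ℝ) (hp : ∀ i, 0 < p i) (D : ℝ) (hD0 : 0 ≤ D)
    (hD : ∀ A : ∀ i, Matrix (Fin (ni i)) (Fin (ni i)) ℝ, (∀ i, (A i).PosDef) →
      ∏ i, (A i).det ^ p i ≤ D * (∑ i, p i • ((L i)ᵀ * A i * L i)).det)
    (f : ∀ i, (Fin (ni i) → ℝ) → ℝ≥0∞) (hf : ∀ i, Measurable (f i)) (hfin : ∀ i, ∫⁻ y, f i y ≠ ⊤) :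
    ∫⁻ x : Fin n → ℝ, ∏ i, (f i ((L i).mulVec x)) ^ p i ≤ ENNReal.ofReal √D * ∏ i, (∫⁻ y, f i y) ^ p i := by
  classical
  have step : ∀ δ : ℝ, 0 < δ → δ < 1 →
      ∫⁻ x : Fin n → ℝ, (∏ i, (f i ((L i).mulVec x)) ^ p i) ^ (1 - δ) * ENNReal.ofReal (Real.exp (-Real.pi * (δ * (x ⬝ᵥ x))))
      ≤ (ENNReal.ofReal √D * ∏ i, (∫⁻ y, f i y) ^ p i) ^ (1 - δ) := by
    intro δ h0 h1
    have hd : 0 < 1 - δ := by linarith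
    obtain ⟨A, hA, hM, hcrit, hle⟩ := BL.extremizer L hL p hp δ h0 h1 D hD0 hD
    have hw := BL.weighted L (fun i => (1 - δ) * p i) (fun i => (mul_pos hd (hp i)).le) δ h0.le A hA _ hM rfl hcrit f hf hfin
    set M := δ • (1 : Matrix (Fin n) (Fin n) ℝ) + ∑ i, ((1 - δ) * p i) • ((L i)ᵀ * A i * L i)
    have hpr : ∀ a : ι → ℝ≥0∞, ∏ i, a i ^ ((1 - δ) * p i) = (∏ i, a i ^ p i) ^ (1 - δ) := by
      intro a
      rw [← ENNReal.prod_rpow_of_nonneg hd.le]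
      refine Finset.prod_congr rfl fun i _ => ?_
      rw [← ENNReal.rpow_mul, mul_comm]
    simp only [hpr] at hw
    have e1 : ENNReal.ofReal (√(∏ i, (A i).det ^ ((1 - δ) * p i))) ≤ ENNReal.ofReal √M.det * ENNReal.ofReal √D ^ (1 - δ) := by
      rw [ENNReal.ofReal_rpow_of_nonneg (Real.sqrt_nonneg _) hd.le, ← ENNReal.ofReal_mul (Real.sqrt_nonneg _)]
      apply ENNReal.ofReal_le_ofReal
      have : √D ^ (1 - δ) = √(D ^ (1 - δ)) := by
        rw [Real.sqrt_eq_rpow, Real.sqrt_eq_rpow, ← Real.rpow_mul hD0, ← Real.rpow_mul hD0, mul_comm]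
      rw [this, ← Real.sqrt_mul hM.det_pos.le, mul_comm]
      exact Real.sqrt_le_sqrt hle
    have hm0 : ENNReal.ofReal √M.det ≠ 0 := by
      have := Real.sqrt_pos.2 hM.det_pos
      simpa using this
    rw [ENNReal.mul_rpow_of_nonneg _ _ hd.le]
    have h2 := hw.trans (mul_le_mul_left e1 _)
    rw [mul_assoc] at h2
    exact (ENNReal.mul_le_mul_iff_right hm0 ENNReal.ofReal_ne_top).1 h2
  set u : ℕ → ℝ := fun k => 1 / ((k:ℝ) + 2) with hu
  have hu0 : ∀ k, 0 < u k := fun k => by simp only [hu]; positivity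
  have hu1 : ∀ k, u k < 1 := fun k => by
    simp only [hu]; rw [div_lt_one (by positivity)]; have : (0:ℝ) ≤ k := by positivity
    linarith
  have hul : Tendsto u atTop (𝓝 0) := by
    have := (tendsto_const_nhds (x := (1:ℝ))).div_atTop (tendsto_atTop_add_const_right atTop (2:ℝ) (tendsto_natCast_atTop_atTop (R := ℝ)))
    exact this
  have hu2 : Tendsto (fun k => 1 - u k) atTop (𝓝 1) := by simpa using hul.const_sub 1
  have hFm : Measurable fun x : Fin n → ℝ => ∏ i, (f i ((L i).mulVec x)) ^ p i := by
    refine Finset.measurable_prod _ fun i _ => ((hf i).comp ?_).pow_const _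
    exact (by unfold mulVec dotProduct; fun_prop : Continuous fun x : Fin n → ℝ => (L i).mulVec x).measurable
  calc ∫⁻ x : Fin n → ℝ, ∏ i, (f i ((L i).mulVec x)) ^ p i
      = ∫⁻ x : Fin n → ℝ, liminf (fun k => (∏ i, (f i ((L i).mulVec x)) ^ p i) ^ (1 - u k) * ENNReal.ofReal (Real.exp (-Real.pi * (u k * (x ⬝ᵥ x))))) atTop := by
        refine lintegral_congr fun x => ?_
        symm
        apply Tendsto.liminf_eq
        have h1 := BL.rpow_lim (∏ i, (f i ((L i).mulVec x)) ^ p i) _ (fun k => sub_pos.2 (hu1 k)) hu2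
        have h2 : Tendsto (fun k => ENNReal.ofReal (Real.exp (-Real.pi * (u k * (x ⬝ᵥ x))))) atTop (𝓝 1) := by
          rw [← ENNReal.ofReal_one]
          apply ENNReal.tendsto_ofReal
          have : Tendsto (fun k => -Real.pi * (u k * (x ⬝ᵥ x))) atTop (𝓝 0) := by
            simpa using (hul.mul_const (x ⬝ᵥ x)).const_mul (-Real.pi)
          have h3 := (Real.continuous_exp.tendsto 0).comp this
          rw [Real.exp_zero] at h3
          exact h3
        simpa using ENNReal.Tendsto.mul h1 (Or.inr ENNReal.one_ne_top) h2 (Or.inl one_ne_zero)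
    _ ≤ liminf (fun k => ∫⁻ x : Fin n → ℝ, (∏ i, (f i ((L i).mulVec x)) ^ p i) ^ (1 - u k) * ENNReal.ofReal (Real.exp (-Real.pi * (u k * (x ⬝ᵥ x))))) atTop := by
        apply lintegral_liminf_le
        intro k
        refine (hFm.pow_const _).mul ?_
        apply Measurable.ennreal_ofReal
        exact (by unfold dotProduct; fun_prop : Continuous fun x : Fin n → ℝ => Real.exp (-Real.pi * (u k * (x ⬝ᵥ x)))).measurable
    _ ≤ liminf (fun k => (ENNReal.ofReal √D * ∏ i, (∫⁻ y, f i y) ^ p i) ^ (1 - u k)) atTop :=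
        liminf_le_liminf (Eventually.of_forall fun k => step (u k) (hu0 k) (hu1 k))
    _ = _ := (BL.rpow_lim _ _ (fun k => sub_pos.2 (hu1 k)) hu2).liminf_eq

lemma BL.upper {ι : Type*} [Fintype ι] {n : ℕ} {ni : ι → ℕ}
    (L : ∀ i, Matrix (Fin (ni i)) (Fin n) ℝ) (hL : ∀ i, Function.Surjective ((L i).mulVec))
    (p : ι → ℝ) (hp : ∀ i, 0 ≤ p i) (D : ℝ) (hD0 : 0 ≤ D)
    (hD : ∀ A : ∀ i, Matrix (Fin (ni i)) (Fin (ni i)) ℝ, (∀ i, (A i).PosDef) →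
      ∏ i, (A i).det ^ p i ≤ D * (∑ i, p i • ((L i)ᵀ * A i * L i)).det)
    (f : ∀ i, (Fin (ni i) → ℝ) → ℝ≥0∞) (hf : ∀ i, Measurable (f i)) (hfin : ∀ i, ∫⁻ y, f i y ≠ ⊤) :
    ∫⁻ x : Fin n → ℝ, ∏ i, (f i ((L i).mulVec x)) ^ p i ≤ ENNReal.ofReal √D * ∏ i, (∫⁻ y, f i y) ^ p i := by
  classical
  have hz : ∀ i, ¬ 0 < p i → p i = 0 := fun i h => le_antisymm (not_lt.1 h) (hp i)
  have hprod : ∀ {β : Type} [CommMonoid β] (g : ι → β), (∀ i, ¬ 0 < p i → g i = 1) →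
      ∏ i, g i = ∏ i : {i // 0 < p i}, g i := by
    intro β _ g hg
    rw [← Fintype.prod_subtype_mul_prod_subtype (fun i => 0 < p i) g,
      Finset.prod_eq_one (fun (i : {i // ¬ 0 < p i}) _ => hg i i.2), mul_one]
  have hsum : ∀ (g : ι → Matrix (Fin n) (Fin n) ℝ), (∀ i, ¬ 0 < p i → g i = 0) →
      ∑ i, g i = ∑ i : {i // 0 < p i}, g i := by
    intro g hg
    rw [← Fintype.sum_subtype_add_sum_subtype (fun i => 0 < p i) g,
      Finset.sum_eq_zero (fun (i : {i // ¬ 0 < p i}) _ => hg i i.2), add_zero]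
  have := BL.upper_pos (ι := {i // 0 < p i}) (ni := fun i => ni i) (fun i => L i) (fun i => hL i) (fun i => p i)
    (fun i => i.2) D hD0 ?_ (fun i => f i) (fun i => hf i) (fun i => hfin i)
  · rw [hprod _ (fun i hi => by rw [hz i hi, ENNReal.rpow_zero])]
    refine le_trans (lintegral_mono fun x => le_of_eq ?_) this
    rw [hprod _ (fun i hi => by rw [hz i hi, ENNReal.rpow_zero])]
  · intro A hA
    have h := hD (fun i => if h : 0 < p i then A ⟨i, h⟩ else 1) (fun i => by
      by_cases h : 0 < p i
      · simpa [h] using hA ⟨i, h⟩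
      · simpa [h] using PosDef.one)
    rw [hprod _ (fun i hi => by simp [hi, hz i hi]), hsum _ (fun i hi => by simp [hz i hi])] at h
    convert h using 4 with i _ i
    · simp [i.2]
    · simp [i.2]
end upper

section both
open Topology Filter

lemma BL.bl_lower {m n : ℕ} {ni : Fin m → ℕ}
    (L : ∀ i, Matrix (Fin (ni i)) (Fin n) ℝ) (p : Fin m → ℝ) (hp : ∀ i, 0 ≤ p i)
    (A : ∀ i, Matrix (Fin (ni i)) (Fin (ni i)) ℝ) (hA : ∀ i, (A i).PosDef) (ε : ℝ) (hε : 0 < ε) :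
    ENNReal.ofReal (∏ i, (A i).det ^ p i) / ENNReal.ofReal (ε • (1 : Matrix (Fin n) (Fin n) ℝ) + ∑ i, p i • ((L i)ᵀ * A i * L i)).det
      ≤ (brascampLieb L p) ^ 2 := by
  set M := ε • (1 : Matrix (Fin n) (Fin n) ℝ) + ∑ i, p i • ((L i)ᵀ * A i * L i) with hMd
  have hM : M.PosDef := (PosDef.one.smul hε).add_posSemidef
    (posSemidef_sum _ fun i _ => (BL.psd_L (L i) (hA i).posSemidef).smul (hp i))
  set f : ∀ i, (Fin (ni i) → ℝ) → ℝ≥0∞ := fun i y => ENNReal.ofReal (Real.exp (-Real.pi * (y ⬝ᵥ (A i).mulVec y))) with hf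
  have hfi : ∀ i, ∫⁻ y, f i y = (ENNReal.ofReal √(A i).det)⁻¹ := fun i => BL.gauss_int (A i) (hA i)
  have hsq : ∀ i, 0 < √(A i).det := fun i => Real.sqrt_pos.2 (hA i).det_pos
  have hfm : ∀ i, Measurable (f i) := fun i => by
    apply Measurable.ennreal_ofReal
    exact (by unfold mulVec dotProduct; fun_prop : Continuous fun y : Fin (ni i) → ℝ => Real.exp (-Real.pi * (y ⬝ᵥ (A i).mulVec y))).measurable
  have h1 : (∫⁻ x : Fin n → ℝ, ∏ i, (f i ((L i).mulVec x)) ^ (p i)) / ∏ i, (∫⁻ y, f i y) ^ (p i) ≤ brascampLieb L p := by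
    unfold brascampLieb
    refine le_iSup_of_le f (le_iSup_of_le hfm (le_iSup_of_le ?_ (le_iSup_of_le ?_ le_rfl)))
    · intro i; rw [hfi]; simp
    · intro i; rw [hfi]; simpa using (hA i).det_pos
  have h2 : (ENNReal.ofReal √M.det)⁻¹ ≤ ∫⁻ x : Fin n → ℝ, ∏ i, (f i ((L i).mulVec x)) ^ (p i) := by
    rw [← BL.gauss_int M hM]
    refine lintegral_mono fun x => ?_
    have : ∀ i, (f i ((L i).mulVec x)) ^ (p i) = ENNReal.ofReal (Real.exp (-Real.pi * (p i * (x ⬝ᵥ ((L i)ᵀ * A i * L i).mulVec x)))) := by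
      intro i
      simp only [hf]
      rw [ENNReal.ofReal_rpow_of_nonneg (Real.exp_pos _).le (hp i), ← Real.exp_mul, BL.quad_L]
      congr 2; ring
    rw [Finset.prod_congr rfl fun i _ => this i, ← ENNReal.ofReal_prod_of_nonneg (fun i _ => (Real.exp_pos _).le), ← Real.exp_sum]
    apply ENNReal.ofReal_le_ofReal
    apply Real.exp_le_exp.2
    have e : x ⬝ᵥ M.mulVec x = ε * (x ⬝ᵥ x) + ∑ i, p i * (x ⬝ᵥ ((L i)ᵀ * A i * L i).mulVec x) := by
      rw [hMd, add_mulVec, dotProduct_add, sum_mulVec, dotProduct_sum]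
      simp [smul_mulVec]
    rw [e, ← Finset.mul_sum]
    have hxx : 0 ≤ x ⬝ᵥ x := by
      unfold dotProduct; exact Finset.sum_nonneg fun i _ => mul_self_nonneg _
    have : 0 ≤ Real.pi * (ε * (x ⬝ᵥ x)) := by have := Real.pi_pos; positivity
    nlinarith
  have h3 : (∏ i, (∫⁻ y, f i y) ^ (p i)) = (ENNReal.ofReal √(∏ i, (A i).det ^ p i))⁻¹ := by
    have e : √(∏ i, (A i).det ^ p i) = ∏ i, √(A i).det ^ p i := by
      rw [Real.sqrt_eq_rpow, ← Real.finsetProd_rpow _ _ (fun i _ => Real.rpow_nonneg (hA i).det_pos.le _)]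
      refine Finset.prod_congr rfl fun i _ => ?_
      rw [Real.sqrt_eq_rpow, ← Real.rpow_mul (hA i).det_pos.le, ← Real.rpow_mul (hA i).det_pos.le, mul_comm]
    rw [e, ENNReal.ofReal_prod_of_nonneg (fun i _ => Real.rpow_nonneg (hsq i).le _)]
    have : ∀ i, (∫⁻ y, f i y) ^ (p i) = (ENNReal.ofReal (√(A i).det ^ p i))⁻¹ := by
      intro i
      rw [hfi, ENNReal.inv_rpow, ENNReal.ofReal_rpow_of_nonneg (hsq i).le (hp i)]
    rw [Finset.prod_congr rfl fun i _ => this i]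
    rw [ENNReal.prod_inv_distrib]
    intro i _ j _ _
    left
    simpa using Real.rpow_pos_of_pos (hsq i) _
  have h4 : ENNReal.ofReal √(∏ i, (A i).det ^ p i) / ENNReal.ofReal √M.det ≤ brascampLieb L p := by
    refine le_trans ?_ h1
    rw [h3, div_eq_mul_inv, div_eq_mul_inv, inv_inv, mul_comm]
    gcongr
  have hP : 0 ≤ ∏ i, (A i).det ^ p i := Finset.prod_nonneg fun i _ => Real.rpow_nonneg (hA i).det_pos.le _
  calc _ = (ENNReal.ofReal √(∏ i, (A i).det ^ p i) / ENNReal.ofReal √M.det) ^ 2 := by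
        rw [div_eq_mul_inv, div_eq_mul_inv, mul_pow, ← ENNReal.inv_pow, ← ENNReal.ofReal_pow (Real.sqrt_nonneg _),
          ← ENNReal.ofReal_pow (Real.sqrt_nonneg _), Real.sq_sqrt hP, Real.sq_sqrt hM.det_pos.le]
    _ ≤ _ := by gcongr

lemma BL.bl_sq {m n : ℕ} {ni : Fin m → ℕ}
    (L : ∀ i, Matrix (Fin (ni i)) (Fin n) ℝ) (hL : ∀ i, Function.Surjective ((L i).mulVec))
    (p : Fin m → ℝ) (hp : ∀ i, 0 ≤ p i) :
    (brascampLieb L p) ^ 2 = ⨆ (A : ∀ i, Matrix (Fin (ni i)) (Fin (ni i)) ℝ) (_ : ∀ i, (A i).PosDef),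
      ENNReal.ofReal (∏ i, (A i).det ^ p i) / ENNReal.ofReal (∑ i, p i • ((L i)ᵀ * A i * L i)).det := by
  apply le_antisymm
  · set D := ⨆ (A : ∀ i, Matrix (Fin (ni i)) (Fin (ni i)) ℝ) (_ : ∀ i, (A i).PosDef),
      ENNReal.ofReal (∏ i, (A i).det ^ p i) / ENNReal.ofReal (∑ i, p i • ((L i)ᵀ * A i * L i)).det with hDdef
    by_cases hD : D = ⊤
    · rw [hD]; exact le_top
    have key : ∀ A : ∀ i, Matrix (Fin (ni i)) (Fin (ni i)) ℝ, (∀ i, (A i).PosDef) →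
      ∏ i, (A i).det ^ p i ≤ D.toReal * (∑ i, p i • ((L i)ᵀ * A i * L i)).det := by
      intro A hA
      have hX : (∑ i, p i • ((L i)ᵀ * A i * L i)).PosSemidef :=
        posSemidef_sum _ fun i _ => (BL.psd_L (L i) (hA i).posSemidef).smul (hp i)
      have h1 : ENNReal.ofReal (∏ i, (A i).det ^ p i) / ENNReal.ofReal (∑ i, p i • ((L i)ᵀ * A i * L i)).det ≤ D := by
        rw [hDdef]; exact le_iSup₂_of_le A hA le_rfl
      have hpos : 0 < ∏ i, (A i).det ^ p i := Finset.prod_pos fun i _ => Real.rpow_pos_of_pos (hA i).det_pos _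
      have hne : ENNReal.ofReal (∏ i, (A i).det ^ p i) ≠ 0 := by simpa using hpos
      have h2 := (ENNReal.div_le_iff_le_mul (Or.inr hD) (Or.inl ENNReal.ofReal_ne_top)).1 h1
      rw [← ENNReal.ofReal_toReal hD, ← ENNReal.ofReal_mul ENNReal.toReal_nonneg] at h2
      exact (ENNReal.ofReal_le_ofReal_iff (mul_nonneg ENNReal.toReal_nonneg hX.det_nonneg)).1 h2
    have hle : brascampLieb L p ≤ ENNReal.ofReal √D.toReal := by
      unfold brascampLieb
      refine iSup_le fun f => iSup_le fun hf => iSup_le fun hf0 => iSup_le fun hft => ?_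
      refine ENNReal.div_le_of_le_mul ?_
      exact BL.upper L hL p hp D.toReal ENNReal.toReal_nonneg key f hf fun i => (hft i).ne
    calc _ ≤ (ENNReal.ofReal √D.toReal) ^ 2 := by gcongr
      _ = D := by
        rw [← ENNReal.ofReal_pow (Real.sqrt_nonneg _), Real.sq_sqrt ENNReal.toReal_nonneg, ENNReal.ofReal_toReal hD]
  · refine iSup₂_le fun A hA => ?_
    have hlim : Tendsto (fun ε : ℝ => ENNReal.ofReal (∏ i, (A i).det ^ p i) /
        ENNReal.ofReal (ε • (1 : Matrix (Fin n) (Fin n) ℝ) + ∑ i, p i • ((L i)ᵀ * A i * L i)).det) (𝓝[>] 0)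
        (𝓝 (ENNReal.ofReal (∏ i, (A i).det ^ p i) / ENNReal.ofReal (∑ i, p i • ((L i)ᵀ * A i * L i)).det)) := by
      refine ENNReal.Tendsto.const_div ?_ (Or.inr ENNReal.ofReal_ne_top)
      apply ENNReal.tendsto_ofReal
      apply tendsto_nhdsWithin_of_tendsto_nhds
      have : Continuous fun ε : ℝ => (ε • (1 : Matrix (Fin n) (Fin n) ℝ) + ∑ i, p i • ((L i)ᵀ * A i * L i)).det :=
        Continuous.matrix_det (by fun_prop)
      simpa using this.tendsto 0
    refine le_of_tendsto hlim ?_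
    filter_upwards [self_mem_nhdsWithin] with ε hε
    exact BL.bl_lower L p hp A hA ε hε

end both

section algebra

lemma BL.cauchyBinet {K : Type*} [Fintype K] [DecidableEq K] {n : ℕ} (w : K → ℝ) (V : Matrix (Fin n) K ℝ) :
    (V * diagonal w * Vᵀ).det = ∑ I : {I : Finset K // I.card = n}, (∏ k ∈ I.1, w k) *
      (Matrix.det (Matrix.of fun (a b : Fin n) =>
        V a (((Fintype.equivFinOfCardEq ((Fintype.card_coe I.1).trans I.2)).symm b : {x // x ∈ I.1}) : K))) ^ 2 := by
  have hpoly : det (1 + (Polynomial.X : Polynomial ℝ) • (V * (diagonal w * Vᵀ)).map Polynomial.C)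
      = det (1 + (Polynomial.X : Polynomial ℝ) • ((diagonal w * Vᵀ) * V).map Polynomial.C) := by
    rw [Matrix.map_mul, ← Matrix.mul_smul, det_one_add_mul_comm, Matrix.smul_mul, ← Matrix.map_mul]
  have h := congrArg (fun P => P.coeff n) hpoly
  simp only [coeff_det_one_add_X_smul_eq_sum_minors] at h
  have h1 : Finset.powersetCard n (Finset.univ : Finset (Fin n)) = {Finset.univ} := by
    have := Finset.powersetCard_self (Finset.univ : Finset (Fin n))
    rwa [Finset.card_fin] at this
  rw [h1, Finset.sum_singleton] at h
  rw [Matrix.mul_assoc]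
  have h2 : (V * (diagonal w * Vᵀ)).det = ((V * (diagonal w * Vᵀ)).submatrix
      (Subtype.val : {x // x ∈ (Finset.univ : Finset (Fin n))} → Fin n) Subtype.val).det := by
    exact (det_submatrix_equiv_self (Equiv.subtypeUnivEquiv (fun x => Finset.mem_univ x)) _).symm
  rw [h2, h, Finset.sum_subtype (p := fun I : Finset K => I.card = n) _ (by simp)]
  refine Finset.sum_congr rfl fun I _ => ?_
  set e := (Fintype.equivFinOfCardEq ((Fintype.card_coe I.1).trans I.2)).symm
  set P := Matrix.of fun (a b : Fin n) => V a (e b : K) with hP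
  rw [← det_submatrix_equiv_self e]
  have e1 : ((diagonal w * Vᵀ * V).submatrix (Subtype.val : I.1 → K) Subtype.val).submatrix e e
      = diagonal (fun b => w (e b)) * Pᵀ * P := by
    ext a b
    simp [mul_apply, hP, diagonal_mul, Finset.mul_sum, diagonal_apply]
  rw [e1, det_mul, det_mul, det_diagonal, det_transpose, Equiv.prod_comp e (fun k => w k), Finset.prod_coe_sort]
  ring

lemma BL.param {n : ℕ} (A : Matrix (Fin n) (Fin n) ℝ) (hA : A.PosDef) :
    ∃ (R : Matrix.specialOrthogonalGroup (Fin n) ℝ) (x : Fin n → ℝ), (∀ j, 0 < x j) ∧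
      A = (R : Matrix (Fin n) (Fin n) ℝ)ᵀ * diagonal x * (R : Matrix (Fin n) (Fin n) ℝ) := by
  obtain ⟨U, x, h1, h2, h⟩ := BL.diagz A hA.1
  have hx : ∀ j, 0 < x j := by
    intro j
    have hn := BL.diag_nn h1 h hA.posSemidef
    refine lt_of_le_of_ne (hn j) fun hz => ?_
    have e1 := BL.diag_det h2 h 0 1
    simp at e1
    rw [Finset.prod_eq_zero (Finset.mem_univ j) hz.symm] at e1
    exact hA.det_pos.ne' e1
  by_cases hd : U.det = 1
  · refine ⟨⟨Uᵀ, ?_⟩, x, hx, ?_⟩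
    · rw [mem_specialOrthogonalGroup_iff, mem_orthogonalGroup_iff]
      exact ⟨by simpa [star_eq_conjTranspose] using h1, by simpa using hd⟩
    · simpa using h
  · have hd1 : U.det * U.det = 1 := by
      nth_rw 2 [← det_transpose]; rw [← det_mul, h2, det_one]
    have hdm : U.det = -1 := (mul_self_eq_one_iff.1 hd1).resolve_left hd
    have hne : Nonempty (Fin n) := by
      by_contra hh
      rw [not_nonempty_iff] at hh
      exact hd det_isEmpty
    obtain ⟨j0⟩ := hne
    set s : Fin n → ℝ := Function.update 1 j0 (-1) with hs
    have hss : ∀ j, s j * s j = 1 := by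
      intro j
      by_cases hj : j = j0
      · subst hj; simp [hs]
      · simp [hs, hj]
    have hsp : ∏ j, s j = -1 := by
      rw [hs, Finset.prod_update_of_mem (Finset.mem_univ _)]; simp
    refine ⟨⟨diagonal s * Uᵀ, ?_⟩, x, hx, ?_⟩
    · rw [mem_specialOrthogonalGroup_iff, mem_orthogonalGroup_iff]
      constructor
      · simp only [star_eq_conjTranspose, conjTranspose_eq_transpose_of_trivial, transpose_mul, transpose_transpose,
          diagonal_transpose]
        calc diagonal s * Uᵀ * (U * diagonal s) = diagonal s * (Uᵀ * U) * diagonal s := by simp only [Matrix.mul_assoc]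
          _ = 1 := by rw [h1]; simp [hss]
      · rw [det_mul, det_diagonal, det_transpose, hsp, hdm]; norm_num
    · simp only [transpose_mul, transpose_transpose, diagonal_transpose]
      rw [h]
      calc U * diagonal x * Uᵀ = U * (diagonal s * diagonal x * diagonal s) * Uᵀ := by
            simp only [diagonal_mul_diagonal]
            congr 3; ext j; linear_combination (-x j) * hss j
        _ = _ := by simp only [Matrix.mul_assoc]

lemma BL.so_mul {n : ℕ} (R : Matrix.specialOrthogonalGroup (Fin n) ℝ) :
    (R : Matrix (Fin n) (Fin n) ℝ)ᵀ * R = 1 := by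
  exact ((mem_orthogonalGroup_iff' _ _).1 (mem_specialOrthogonalGroup_iff.1 R.2).1)

lemma BL.param_pd {n : ℕ} (R : Matrix.specialOrthogonalGroup (Fin n) ℝ) (x : Fin n → ℝ) (hx : ∀ j, 0 < x j) :
    ((R : Matrix (Fin n) (Fin n) ℝ)ᵀ * diagonal x * (R : Matrix (Fin n) (Fin n) ℝ)).PosDef := by
  rw [← conjTranspose_eq_transpose_of_trivial]
  apply PosDef.conjTranspose_mul_mul_same (PosDef.diagonal hx)
  apply Matrix.mulVec_injective_of_isUnit
  rw [Matrix.isUnit_iff_isUnit_det]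
  exact isUnit_iff_exists_inv'.2 ⟨_, by rw [← det_mul, BL.so_mul R, det_one]⟩

lemma BL.param_det {n : ℕ} (R : Matrix.specialOrthogonalGroup (Fin n) ℝ) (x : Fin n → ℝ) :
    ((R : Matrix (Fin n) (Fin n) ℝ)ᵀ * diagonal x * (R : Matrix (Fin n) (Fin n) ℝ)).det = ∏ j, x j := by
  have h : (R : Matrix (Fin n) (Fin n) ℝ).det = 1 := (mem_specialOrthogonalGroup_iff.1 R.2).2
  rw [det_mul, det_mul, det_transpose, h, det_diagonal]; ring

lemma BL.denom {m n : ℕ} {ni : Fin m → ℕ}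
    (L : ∀ i, Matrix (Fin (ni i)) (Fin n) ℝ) (p : Fin m → ℝ) (hp : ∀ i, 0 ≤ p i)
    (R : ∀ i, Matrix.specialOrthogonalGroup (Fin (ni i)) ℝ)
    (lam : (Σ i : Fin m, Fin (ni i)) → ℝ) (hl : ∀ k, 0 < lam k) :
    ∑ I : {I : Finset (Σ i : Fin m, Fin (ni i)) // I.card = n},
      ENNReal.ofReal ((∏ k ∈ I.1, lam k) * (∏ k ∈ I.1, p k.1) * bartheD L R I) =
    ENNReal.ofReal (∑ i, p i • ((L i)ᵀ * ((R i : Matrix (Fin (ni i)) (Fin (ni i)) ℝ)ᵀ *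
      diagonal (fun j => lam ⟨i, j⟩) * (R i : Matrix (Fin (ni i)) (Fin (ni i)) ℝ)) * L i)).det := by
  rw [← ENNReal.ofReal_sum_of_nonneg]
  · congr 1
    have h := BL.cauchyBinet (n := n) (fun k : Σ i : Fin m, Fin (ni i) => lam k * p k.1)
      (Matrix.of fun a k => bartheVec L R k a)
    have e : (∑ i, p i • ((L i)ᵀ * ((R i : Matrix (Fin (ni i)) (Fin (ni i)) ℝ)ᵀ *
        diagonal (fun j => lam ⟨i, j⟩) * (R i : Matrix (Fin (ni i)) (Fin (ni i)) ℝ)) * L i)) =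
        (Matrix.of fun a k => bartheVec L R k a) * diagonal (fun k : Σ i : Fin m, Fin (ni i) => lam k * p k.1) *
        (Matrix.of fun a k => bartheVec L R k a)ᵀ := by
      ext a b
      have hb : ∀ i j c, bartheVec L R ⟨i, j⟩ c = ((L i)ᵀ * (R i : Matrix (Fin (ni i)) (Fin (ni i)) ℝ)ᵀ) c j := by
        intro i j c
        simp only [bartheVec, mulVec_mulVec, mulVec_single_one]
        rfl
      rw [Matrix.sum_apply, mul_apply, Fintype.sum_sigma]
      refine Finset.sum_congr rfl fun i _ => ?_
      have e2 : (L i)ᵀ * ((R i : Matrix (Fin (ni i)) (Fin (ni i)) ℝ)ᵀ *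
        diagonal (fun j => lam ⟨i, j⟩) * (R i : Matrix (Fin (ni i)) (Fin (ni i)) ℝ)) * L i =
        ((L i)ᵀ * (R i : Matrix (Fin (ni i)) (Fin (ni i)) ℝ)ᵀ) * diagonal (fun j => lam ⟨i, j⟩) *
        ((L i)ᵀ * (R i : Matrix (Fin (ni i)) (Fin (ni i)) ℝ)ᵀ)ᵀ := by
        simp only [transpose_mul, transpose_transpose, Matrix.mul_assoc]
      rw [e2, Matrix.smul_apply, mul_apply, smul_eq_mul, Finset.mul_sum]
      refine Finset.sum_congr rfl fun j _ => ?_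
      simp only [mul_diagonal, transpose_apply, of_apply, hb]
      ring
    rw [e, h]
    refine Finset.sum_congr rfl fun I _ => ?_
    rw [Finset.prod_mul_distrib]
    rfl
  · intro I _
    have : 0 ≤ ∏ k ∈ I.1, lam k := Finset.prod_nonneg fun k _ => (hl k).le
    have : 0 ≤ ∏ k ∈ I.1, p k.1 := Finset.prod_nonneg fun k _ => hp k.1
    have : 0 ≤ bartheD L R I := sq_nonneg _
    positivity

lemma BL.numer {m : ℕ} {ni : Fin m → ℕ} (p : Fin m → ℝ)
    (R : ∀ i, Matrix.specialOrthogonalGroup (Fin (ni i)) ℝ)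
    (lam : (Σ i : Fin m, Fin (ni i)) → ℝ) (hl : ∀ k, 0 < lam k) :
    ∏ k : Σ i : Fin m, Fin (ni i), lam k ^ p k.1 =
    ∏ i, ((R i : Matrix (Fin (ni i)) (Fin (ni i)) ℝ)ᵀ *
      diagonal (fun j => lam ⟨i, j⟩) * (R i : Matrix (Fin (ni i)) (Fin (ni i)) ℝ)).det ^ p i := by
  rw [Fintype.prod_sigma]
  refine Finset.prod_congr rfl fun i _ => ?_
  rw [BL.param_det, ← Real.finsetProd_rpow _ _ (fun j _ => (hl _).le)]

end algebra

/-- **Generalised Barthe formula.** For surjective linear maps `L i : ℝⁿ → ℝ^{n_i}`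
(`n_i ≤ n`) and exponents `p i ∈ [0,1]`, writing `q_k = p_i` for `k` in the `i`-th
block and `𝓘` for the `n`-element subsets of the index set,
`BL(L, p)² = sup { (∏ₖ λₖ^{qₖ}) / (∑_{I∈𝓘} λ_I q_I d_I(L, R)) : λₖ > 0, R_i ∈ SO(n_i) }`,
both sides being elements of `[0,∞]`. -/
theorem brascampLieb_sq_eq_iSup {m n : ℕ} {ni : Fin m → ℕ} (hni : ∀ i, ni i ≤ n)
    (L : ∀ i, Matrix (Fin (ni i)) (Fin n) ℝ)
    (hL : ∀ i, Function.Surjective ((L i).mulVec))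
    (p : Fin m → ℝ) (hp : ∀ i, p i ∈ Set.Icc (0:ℝ) 1) :
    (brascampLieb L p) ^ 2 =
      ⨆ (R : ∀ i, Matrix.specialOrthogonalGroup (Fin (ni i)) ℝ)
        (lam : (Σ i : Fin m, Fin (ni i)) → ℝ) (_ : ∀ k, 0 < lam k),
        ENNReal.ofReal (∏ k : Σ i : Fin m, Fin (ni i), lam k ^ p k.1) /
          ∑ I : {I : Finset (Σ i : Fin m, Fin (ni i)) // I.card = n},
            ENNReal.ofReal
              ((∏ k ∈ I.1, lam k) * (∏ k ∈ I.1, p k.1) * bartheD L R I) := by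
  rw [BL.bl_sq L hL p fun i => (hp i).1]
  apply le_antisymm
  · refine iSup₂_le fun A hA => ?_
    choose R x hx hAx using fun i => BL.param (A i) (hA i)
    refine le_iSup_of_le R (le_iSup₂_of_le (fun k => x k.1 k.2) (fun k => hx k.1 k.2) ?_)
    rw [BL.numer p R _ (fun k => hx k.1 k.2), BL.denom L p (fun i => (hp i).1) R _ (fun k => hx k.1 k.2)]
    simp only [← hAx]
    exact le_rfl
  · refine iSup_le fun R => iSup₂_le fun lam hl => ?_
    rw [BL.numer p R _ hl, BL.denom L p (fun i => (hp i).1) R _ hl]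
    exact le_iSup₂_of_le (f := fun (A : ∀ i, Matrix (Fin (ni i)) (Fin (ni i)) ℝ) (_ : ∀ i, (A i).PosDef) =>
      ENNReal.ofReal (∏ i, (A i).det ^ p i) / ENNReal.ofReal (∑ i, p i • ((L i)ᵀ * A i * L i)).det)
      _ (fun i => BL.param_pd (R i) _ fun j => hl _) le_rfl
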